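/- arXiv:1310.4892 — 2 statements merged into one kernel-verified Lean document; each statement's English description precedes it below -/
import Mathlib

section
/- Let α ≥ 1. Fix the data: a_0 = 0, a_{l+1} = a_l + 1 + l·a_l and I_l = [a_l, a_{l+1}) ∩ ω; a sequence (δ_m)_{m<ω} in (0,1) with 0 < inf_m δ_m ≤ sup_m δ_m < 1; a strictly increasing sequence (k_m)_{m<ω} of natural numbers with k_0 ≥ 2 and k_{m+1} ≥ 2·k_m. For U ⊆ ω define u_U(0) = 1 and, for n > 0, u_U(n) = δ_m·u_U(n−1) if n = k_m for some m ∈ I_l with l ∈ U, and u_U(n) = u_U(n−1) otherwise. Let φ : [0,1] → [0,∞) be continuous and essentially increasing on [0,1] with φ(x) > 0 for x > 0 and φ(x²) ≥ λ·φ(x) for some λ > 0 and all x ∈ [0,1]. For each U ⊆ ω let φ_U : [0,1] → [0,∞) be continuous increasing with φ_U(1/2^n) = u_U(n) for every n, and set f_U(x) = x^α·φ(x)·φ_U(x). If U, V ⊆ ω are such that U \ V and V \ U are both infinite, then E_{f_U} and E_{f_V} are Borel incomparable: neither E_{f_U} ≤_B E_{f_V} nor E_{f_V} ≤_B E_{f_U}.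 -/
open Set

/-- `f` is essentially increasing on `D`: for some `C ≥ 1`,
`x ≤ y` implies `f x ≤ C * f y` for `x, y ∈ D`. -/
def EssIncOn (f : ℝ → ℝ) (D : Set ℝ) : Prop :=
  ∃ C : ℝ, 1 ≤ C ∧ ∀ x ∈ D, ∀ y ∈ D, x ≤ y → f x ≤ C * f y

/-- `(f x)_{x ∈ D} ≈ (g x)_{x ∈ D}`: for some `C ≥ 1`,
`g x / C ≤ f x ≤ C * g x` for all `x ∈ D`. -/
def EquivOn (f g : ℝ → ℝ) (D : Set ℝ) : Prop :=
  ∃ C : ℝ, 1 ≤ C ∧ ∀ x ∈ D, g x / C ≤ f x ∧ f x ≤ C * g x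

/-- `(u n) ≈ (v n)`: for some `C ≥ 1`, `v n / C ≤ u n ≤ C * v n` for all `n`. -/
def SeqEquiv (u v : ℕ → ℝ) : Prop :=
  ∃ C : ℝ, 1 ≤ C ∧ ∀ n, v n / C ≤ u n ∧ u n ≤ C * v n

/-- The relation `E_f` on `[0,1]^ω`: `(x_n) E_f (y_n)` iff `Σ f(|x_n − y_n|) < ∞`
(for `f ≥ 0` this is equivalent to summability). -/
def EF (f : ℝ → ℝ) (x y : ℕ → Icc (0:ℝ) 1) : Prop :=
  Summable fun n => f |(x n : ℝ) - (y n : ℝ)|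

/-- Borel reducibility of binary relations. -/
def BorelReducible {X Y : Type*} [MeasurableSpace X] [MeasurableSpace Y]
    (E : X → X → Prop) (F : Y → Y → Prop) : Prop :=
  ∃ θ : X → Y, Measurable θ ∧ ∀ x y, E x y ↔ F (θ x) (θ y)

/-- The relation `ℝ^ω/ℓ_p`: `x E y` iff `Σ |x_n − y_n|^p < ∞`. -/
def lpRel (p : ℝ) (x y : ℕ → ℝ) : Prop :=
  Summable fun n => |x n - y n| ^ p


/-- A Borel map is continuous on a countable intersection of dense open sets. -/
theorem exists_contOn {X Y : Type*} [TopologicalSpace X] [BaireSpace X] [MeasurableSpace X] [BorelSpace X]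
    [TopologicalSpace Y] [SecondCountableTopology Y] [MeasurableSpace Y] [BorelSpace Y]
    (θ : X → Y) (hθ : Measurable θ) :
    ∃ D : ℕ → Set X, (∀ i, IsOpen (D i)) ∧ (∀ i, Dense (D i)) ∧ ContinuousOn θ (⋂ i, D i) := by
  classical
  have hB := TopologicalSpace.isBasis_countableBasis Y
  have hcount := TopologicalSpace.countable_countableBasis Y
  have h1 : ∀ b ∈ TopologicalSpace.countableBasis Y, ∃ O : Set X, IsOpen O ∧
      (θ ⁻¹' b) =ᶠ[residual X] O := by
    intro b hb
    have hm : MeasurableSet (θ ⁻¹' b) := hθ (hB.isOpen hb).measurableSet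
    obtain ⟨O, hO, h⟩ := hm.residualEq_isOpen
    exact ⟨O, hO, h⟩
  choose! O hO hOe using h1
  have h2 : ∀ᶠ x in residual X, ∀ b ∈ TopologicalSpace.countableBasis Y, (x ∈ θ ⁻¹' b ↔ x ∈ O b) := by
    rw [eventually_countable_ball hcount]
    intro b hb
    filter_upwards [hOe b hb] with x hx
    exact iff_of_eq hx
  obtain ⟨S, hSo, hSd, hSc, hS⟩ := mem_residual_iff.1 h2
  obtain ⟨D, hD⟩ := (hSc.insert univ).exists_eq_range (insert_nonempty _ _)
  have hDmem : ∀ i, D i = univ ∨ D i ∈ S := by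
    intro i
    have : D i ∈ insert univ S := by rw [hD]; exact mem_range_self i
    simpa using this
  refine ⟨D, ?_, ?_, ?_⟩
  · intro i
    rcases hDmem i with h | h
    · rw [h]; exact isOpen_univ
    · exact hSo _ h
  · intro i
    rcases hDmem i with h | h
    · rw [h]; exact dense_univ
    · exact hSd _ h
  · have hsub : ∀ x ∈ ⋂ i, D i, ∀ b ∈ TopologicalSpace.countableBasis Y, (x ∈ θ ⁻¹' b ↔ x ∈ O b) := by
      intro x hx
      apply hS
      intro t ht
      have : t ∈ range D := by rw [← hD]; exact mem_insert_of_mem _ ht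
      obtain ⟨i, rfl⟩ := this
      exact mem_iInter.1 hx i
    rw [continuousOn_iff_continuous_domRestrict]
    rw [hB.continuous_iff]
    intro b hb
    have : (⋂ i, D i).domRestrict θ ⁻¹' b = Subtype.val ⁻¹' (O b) := by
      ext ⟨x, hx⟩
      exact hsub x hx b hb
    rw [this]
    exact (hO b hb).preimage continuous_subtype_val

def ov (L : ℕ) (s z : ℕ → ℕ) : ℕ → ℕ := fun p => if p < L then s p else z p

theorem ov_cont (L s) : Continuous (ov L s) := by
  refine continuous_pi fun p => ?_
  unfold ov
  by_cases h : p < L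
  · simp only [h, if_true]; exact continuous_const
  · simp only [h, if_false]; exact continuous_apply p

theorem nhds_cyl (z : ℕ → ℕ) (W : Set (ℕ → ℕ)) (hW : W ∈ nhds z) :
    ∃ L, ∀ x : ℕ → ℕ, (∀ p < L, x p = z p) → x ∈ W := by
  obtain ⟨O, hOW, hO, hz⟩ := mem_nhds_iff.1 hW
  obtain ⟨I, u, hu, hsub⟩ := isOpen_pi_iff.1 hO z hz
  refine ⟨I.sup id + 1, fun x hx => hOW (hsub ?_)⟩
  intro p hp
  have : p ≤ I.sup id := Finset.le_sup (f := id) hp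
  rw [hx p (by omega)]
  exact (hu p hp).2

theorem cyl_nhds (z : ℕ → ℕ) (L : ℕ) : {x : ℕ → ℕ | ∀ p < L, x p = z p} ∈ nhds z := by
  have : {x : ℕ → ℕ | ∀ p < L, x p = z p} = ⋂ p ∈ Finset.range L, {x | x p = z p} := by
    ext x; simp
  rw [this]
  refine (Filter.biInter_finset_mem _).2 fun p _ => ?_
  have : IsOpen {x : ℕ → ℕ | x p = z p} := by
    have h := (continuous_apply (A := fun _ : ℕ => ℕ) p).isOpen_preimage {z p} (isOpen_discrete _)
    exact h
  exact this.mem_nhds rfl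

theorem ov_dense (L s) (D : Set (ℕ → ℕ)) (hD : Dense D) : Dense (ov L s ⁻¹' D) := by
  intro z
  rw [mem_closure_iff_nhds]
  intro W hW
  obtain ⟨M, hM⟩ := nhds_cyl z W hW
  obtain ⟨x, hx1, hx2⟩ := mem_closure_iff_nhds.1 (hD (ov L s z)) _ (cyl_nhds (ov L s z) (max L M))
  refine ⟨ov L z x, hM _ ?_, ?_⟩
  · intro p hp
    by_cases h : p < L
    · simp [ov, h]
    · have := hx1 p (by omega)
      simp [ov, h] at this ⊢; exact this
  · have : ov L s (ov L z x) = x := by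
      ext p
      by_cases h : p < L
      · have := hx1 p (by omega)
        simp [ov, h] at this ⊢; exact this.symm
      · simp [ov, h]
    simpa [this] using hx2

theorem step {Y : Type*} [TopologicalSpace Y] (θ : (ℕ → ℕ) → (ℕ → Y)) (d : Y → Y → ℝ)
    (hd : Continuous fun p : Y × Y => d p.1 p.2) (hd0 : ∀ a, d a a = 0)
    (D : ℕ → Set (ℕ → ℕ)) (hDo : ∀ i, IsOpen (D i)) (hDd : ∀ i, Dense (D i))
    (hc : ContinuousOn θ (⋂ i, D i))
    (hfin : ∀ x y : ℕ → ℕ, (∃ L, ∀ p ≥ L, x p = y p) → Summable fun k => d (θ x k) (θ y k))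
    (L m i : ℕ) (S : Set (ℕ → ℕ)) (hS : S.Finite) (ε : ℝ) (hε : 0 < ε) :
    ∃ L' ≥ L, ∃ m' > m, ∃ τ : ℕ → ℕ, ∀ z z' : ℕ → ℕ,
      (∀ p, L ≤ p → p < L' → z p = τ p) → (∀ p, L ≤ p → p < L' → z' p = τ p) →
      ∀ s ∈ S, ov L s z ∈ D i ∧
        (ov L s z ∈ (⋂ i, D i) → ov L s z' ∈ (⋂ i, D i) →
          ∑ k ∈ Finset.range m', d (θ (ov L s z) k) (θ (ov L s z') k) ≤ ε) ∧
        (∀ t ∈ S, ov L s z ∈ (⋂ i, D i) → ov L t z ∈ (⋂ i, D i) → ∀ M,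
          ∑ k ∈ Finset.Ico m' M, d (θ (ov L s z) k) (θ (ov L t z) k) ≤ ε) := by
  classical
  set G := ⋂ i, D i with hG
  -- the good set
  set H : Set (ℕ → ℕ) := ⋂ s ∈ S, ⋂ i, ov L s ⁻¹' (D i) with hH
  have hHmem : ∀ z, z ∈ H ↔ ∀ s ∈ S, ov L s z ∈ G := by
    intro z; simp [hH, hG]
  have hHG : IsGδ H := by
    apply IsGδ.biInter hS.countable
    intro s _
    apply IsGδ.iInter
    intro i
    exact ((hDo i).preimage (ov_cont L s)).isGδ
  have hHd : Dense H := by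
    apply dense_biInter_of_Gδ _ hS.countable
    · intro s _
      apply dense_iInter_of_isOpen
      · intro i; exact (hDo i).preimage (ov_cont L s)
      · intro i; exact ov_dense L s _ (hDd i)
    · intro s _
      apply IsGδ.iInter
      intro i
      exact ((hDo i).preimage (ov_cont L s)).isGδ
  have hcomp : ∀ s, ContinuousOn (fun z => θ (ov L s z)) (ov L s ⁻¹' G) := by
    intro s
    exact hc.comp (ov_cont L s).continuousOn (fun z hz => hz)
  -- closed cover
  let B : ℕ → Set (ℕ → ℕ) := fun q => {z | ∀ s ∈ S, ∀ t ∈ S, ∀ M,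
    ∑ k ∈ Finset.Ico (m + 1 + q) M, d (θ (ov L s z) k) (θ (ov L t z) k) ≤ ε}
  have hcover : H ⊆ ⋃ q, closure (B q ∩ H) := by
    intro z hz
    have h1 : ∀ s ∈ S, ∀ t ∈ S, ∃ q0, ∀ q ≥ q0, ∀ M,
        ∑ k ∈ Finset.Ico (m + 1 + q) M, d (θ (ov L s z) k) (θ (ov L t z) k) ≤ ε := by
      intro s _ t _
      have hsum := hfin (ov L s z) (ov L t z) ⟨L, fun p hp => by simp [ov, not_lt.2 hp]⟩
      have := hsum.tendsto_sum_tsum_nat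
      have hCau := this.cauchySeq
      rw [Metric.cauchySeq_iff] at hCau
      obtain ⟨q0, hq0⟩ := hCau ε hε
      refine ⟨q0, fun q hq M => ?_⟩
      by_cases hM : m + 1 + q ≤ M
      · have h := hq0 M (by omega) (m+1+q) (by omega)
        rw [Finset.sum_Ico_eq_sub _ hM]
        rw [Real.dist_eq] at h
        exact (le_abs_self _).trans h.le
      · rw [Finset.Ico_eq_empty (by omega)]; simpa using hε.le
    choose! q0 hq0 using h1
    let Q := hS.toFinset.sup fun s => hS.toFinset.sup fun t => q0 s t
    refine mem_iUnion.2 ⟨Q, subset_closure ⟨?_, hz⟩⟩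
    intro s hs t ht M
    refine hq0 s hs t ht Q ?_ M
    have e1 : q0 s t ≤ hS.toFinset.sup fun t => q0 s t :=
      Finset.le_sup (f := fun t => q0 s t) (hS.mem_toFinset.2 ht)
    exact e1.trans (Finset.le_sup (f := fun s => hS.toFinset.sup fun t => q0 s t) (hS.mem_toFinset.2 hs))
  have hdense := hHG.dense_iUnion_interior_of_closed hHd (fun q => isClosed_closure) hcover
  obtain ⟨z1, hz1⟩ := hdense.nonempty
  obtain ⟨q, hz1⟩ := mem_iUnion.1 hz1
  set m' := m + 1 + q with hm'
  set W := interior (closure (B q ∩ H)) with hW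
  have hWB : ∀ z ∈ W, ∀ s ∈ S, ∀ t ∈ S, ov L s z ∈ G → ov L t z ∈ G → ∀ M,
      ∑ k ∈ Finset.Ico m' M, d (θ (ov L s z) k) (θ (ov L t z) k) ≤ ε := by
    intro z hz s hs t ht hsG htG M
    have hcl : z ∈ closure (B q ∩ H) := interior_subset hz
    have hne : (nhdsWithin z (B q ∩ H)).NeBot := mem_closure_iff_nhdsWithin_neBot.1 hcl
    have hcon : Filter.Tendsto (fun z => ∑ k ∈ Finset.Ico m' M, d (θ (ov L s z) k) (θ (ov L t z) k))
        (nhdsWithin z (B q ∩ H)) (nhds (∑ k ∈ Finset.Ico m' M, d (θ (ov L s z) k) (θ (ov L t z) k))) := by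
      refine tendsto_finsetSum _ fun k _ => ?_
      have hs' := (continuous_apply k).continuousAt.comp_continuousWithinAt
        ((hcomp s z hsG).mono (fun x hx => (hHmem x).1 hx.2 s hs : B q ∩ H ⊆ ov L s ⁻¹' G))
      have ht' := (continuous_apply k).continuousAt.comp_continuousWithinAt
        ((hcomp t z htG).mono (fun x hx => (hHmem x).1 hx.2 t ht : B q ∩ H ⊆ ov L t ⁻¹' G))
      have hc2 := (hd.tendsto (θ (ov L s z) k, θ (ov L t z) k))
      rw [nhds_prod_eq] at hc2
      exact hc2.comp (Filter.Tendsto.prodMk hs' ht')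
    refine le_of_tendsto hcon ?_
    filter_upwards [self_mem_nhdsWithin] with x hx
    exact hx.1 s hs t ht M
  obtain ⟨z2, hz2W, hz2H⟩ := hHd.inter_open_nonempty W isOpen_interior ⟨z1, hz1⟩
  -- neighbourhood conditions
  have n1 : W ∈ nhds z2 := isOpen_interior.mem_nhds hz2W
  have n2 : (⋂ s ∈ S, ov L s ⁻¹' (D i)) ∈ nhds z2 := by
    refine (Filter.biInter_mem hS).2 fun s hs => ?_
    exact ((hDo i).preimage (ov_cont L s)).mem_nhds (mem_iInter.1 ((hHmem z2).1 hz2H s hs) i)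
  have n3 : ∀ s ∈ S, ∃ N ∈ nhds z2, ∀ z ∈ N, ∀ z' ∈ N, ov L s z ∈ G → ov L s z' ∈ G →
      ∑ k ∈ Finset.range m', d (θ (ov L s z) k) (θ (ov L s z') k) ≤ ε := by
    intro s hs
    have hcs : ContinuousWithinAt (fun z => θ (ov L s z)) (ov L s ⁻¹' G) z2 :=
      hcomp s z2 ((hHmem z2).1 hz2H s hs)
    have hF : Continuous fun p : (ℕ → Y) × (ℕ → Y) => ∑ k ∈ Finset.range m', d (p.1 k) (p.2 k) := by
      refine continuous_finsetSum _ fun k _ => ?_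
      have h1 : Continuous fun p : (ℕ → Y) × (ℕ → Y) => (p.1 k, p.2 k) := by fun_prop
      exact hd.comp h1
    have hT : Filter.Tendsto (fun p : (ℕ → ℕ) × (ℕ → ℕ) =>
        ∑ k ∈ Finset.range m', d (θ (ov L s p.1) k) (θ (ov L s p.2) k))
        (nhdsWithin z2 (ov L s ⁻¹' G) ×ˢ nhdsWithin z2 (ov L s ⁻¹' G)) (nhds 0) := by
      have h0 := hF.tendsto (θ (ov L s z2), θ (ov L s z2))
      simp only [hd0, Finset.sum_const_zero] at h0
      rw [nhds_prod_eq] at h0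
      exact h0.comp (Filter.Tendsto.prodMap hcs hcs)
    have hev := hT.eventually (Iio_mem_nhds hε)
    obtain ⟨N, hN, hNN⟩ := (Filter.eventually_prod_self_iff (r := fun x y => ∑ k ∈ Finset.range m', d (θ (ov L s x) k) (θ (ov L s y) k) < ε)).1 hev
    obtain ⟨N', hN', hsub⟩ := mem_nhdsWithin_iff_exists_mem_nhds_inter.1 hN
    refine ⟨N', hN', fun z hz z' hz' hg hg' => ?_⟩
    exact (hNN z (hsub ⟨hz, hg⟩) z' (hsub ⟨hz', hg'⟩)).le
  choose! N hN hNN using n3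
  have n3' : (⋂ s ∈ S, N s) ∈ nhds z2 := (Filter.biInter_mem hS).2 hN
  obtain ⟨L1, hL1⟩ := nhds_cyl z2 _ (Filter.inter_mem n1 (Filter.inter_mem n2 n3'))
  refine ⟨max L L1, le_max_left _ _, m', by omega, z2, ?_⟩
  have hmod : ∀ z : ℕ → ℕ, (∀ p, L ≤ p → p < max L L1 → z p = z2 p) →
      ov L z2 z ∈ W ∩ ((⋂ s ∈ S, ov L s ⁻¹' (D i)) ∩ ⋂ s ∈ S, N s) := by
    intro z hz
    apply hL1
    intro p hp
    by_cases h : p < L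
    · simp [ov, h]
    · simp only [ov, h, if_false]; exact hz p (by omega) (by omega)
  have hovov : ∀ s z, ov L s (ov L z2 z) = ov L s z := by
    intro s z; ext p; by_cases h : p < L <;> simp [ov, h]
  intro z z' hz hz' s hs
  have A := hmod z hz
  have A' := hmod z' hz'
  refine ⟨?_, ?_, ?_⟩
  · have := mem_iInter₂.1 A.2.1 s hs
    simpa [hovov] using this
  · intro g g'
    have := hNN s hs _ (mem_iInter₂.1 A.2.2 s hs) _ (mem_iInter₂.1 A'.2.2 s hs)
    rw [hovov, hovov] at this
    exact this g g'
  · intro t ht g g' M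
    have := hWB _ A.1 s hs t ht
    rw [hovov, hovov] at this
    exact this g g' M



structure St where
  L : ℕ
  m : ℕ
  P : (ℕ → ℕ) → (ℕ → ℕ)

theorem modular {Y : Type*} [TopologicalSpace Y] (θ : (ℕ → ℕ) → (ℕ → Y)) (d : Y → Y → ℝ)
    (hd : Continuous fun p : Y × Y => d p.1 p.2) (hd0 : ∀ a, d a a = 0) (hdn : ∀ a b, 0 ≤ d a b)
    (K : ℝ) (hK : 0 ≤ K) (htri : ∀ a b c, d a c ≤ K * (d a b + d b c))
    (D : ℕ → Set (ℕ → ℕ)) (hDo : ∀ i, IsOpen (D i)) (hDd : ∀ i, Dense (D i))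
    (hc : ContinuousOn θ (⋂ i, D i))
    (hfin : ∀ x y : ℕ → ℕ, (∃ L, ∀ p ≥ L, x p = y p) → Summable fun k => d (θ x k) (θ y k))
    (F : ℕ → Finset ℕ) :
    ∃ (ι : (ℕ → ℕ) → (ℕ → ℕ)) (n m : ℕ → ℕ), StrictMono n ∧ StrictMono m ∧ m 0 = 0 ∧
      (∀ v i, ι v (n i) = v i) ∧ (∀ p, p ∉ range n → ∀ v v', ι v p = ι v' p) ∧
      ∀ v v', (∀ j, v j ∈ F j) → (∀ j, v' j ∈ F j) → ∀ i, v i = v' i →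
        ∑ k ∈ Finset.Ico (m i) (m (i+1)), d (θ (ι v) k) (θ (ι v') k) ≤ K * (2 * (1/2)^i) := by
  classical
  set G := ⋂ i, D i with hG
  let PF : Set (ℕ → ℕ) := {v | ∀ j, v j ∈ F j}
  let Inv : ℕ → St → Prop := fun i st => 1 ≤ st.L ∧ (st.P '' PF).Finite ∧
    (∀ v v', (∀ j ≤ i, v j = v' j) → st.P v = st.P v') ∧
    ∀ v, st.P v (st.L - 1) = v i
  let R : ℕ → St → St → Prop := fun i st st' =>
    st.L < st'.L ∧ st.m < st'.m ∧ (∀ v, ∀ p < st.L, st'.P v p = st.P v p) ∧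
    (∀ v v' p, st.L ≤ p → p < st'.L - 1 → st'.P v p = st'.P v' p) ∧
    (∀ v ∈ PF, ∀ x, (∀ p < st'.L - 1, x p = st'.P v p) → x ∈ D i) ∧
    (∀ v ∈ PF, ∀ x x', (∀ p < st'.L - 1, x p = st'.P v p) → (∀ p < st'.L - 1, x' p = st'.P v p) →
      x ∈ G → x' ∈ G → ∑ k ∈ Finset.range st'.m, d (θ x k) (θ x' k) ≤ (1/2)^(i+1)) ∧
    (∀ v ∈ PF, ∀ v' ∈ PF, ∀ x x', (∀ p < st'.L - 1, x p = st'.P v p) →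
      (∀ p < st'.L - 1, x' p = st'.P v' p) → (∀ p ≥ st'.L - 1, x p = x' p) →
      x ∈ G → x' ∈ G → ∀ M, ∑ k ∈ Finset.Ico st'.m M, d (θ x k) (θ x' k) ≤ (1/2)^(i+1))
  have hnext : ∀ i st, Inv i st → ∃ st', Inv (i+1) st' ∧ R i st st' := by
    rintro i st ⟨hL1, hfinS, hdep, hlast⟩
    obtain ⟨L', hL', m', hm', τ, hτ⟩ := step θ d hd hd0 D hDo hDd hc hfin st.L st.m i _ hfinS
      ((1/2)^(i+1)) (by positivity)
    let P' : (ℕ → ℕ) → (ℕ → ℕ) := fun v p =>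
      if p < st.L then st.P v p else if p < L' then τ p else v (i+1)
    have hovx : ∀ (v x : ℕ → ℕ), (∀ p < L', x p = P' v p) → ov st.L (st.P v) x = x := by
      intro v x hx
      ext p
      by_cases h : p < st.L
      · have := hx p (by omega)
        simp only [P', h, if_true] at this
        simp [ov, h, this]
      · simp [ov, h]
    have hxτ : ∀ (v x : ℕ → ℕ), (∀ p < L', x p = P' v p) → ∀ p, st.L ≤ p → p < L' → x p = τ p := by
      intro v x hx p h1 h2
      have := hx p h2
      simpa [P', not_lt.2 h1, h2] using this
    refine ⟨⟨L' + 1, m', P'⟩, ⟨by simp, ?_, ?_, ?_⟩, ?_, ?_, ?_, ?_, ?_, ?_, ?_⟩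
    · refine (((hfinS.prod (F (i+1)).finite_toSet).image (fun q : (ℕ → ℕ) × ℕ => fun p =>
        if p < st.L then q.1 p else if p < L' then τ p else q.2))).subset ?_
      rintro _ ⟨v, hv, rfl⟩
      exact ⟨(st.P v, v (i+1)), ⟨⟨v, hv, rfl⟩, hv (i+1)⟩, rfl⟩
    · intro v v' h
      ext p
      simp only [P']
      rw [hdep v v' (fun j hj => h j (by omega)), h (i+1) le_rfl]
    · intro v
      simp [P', not_lt.2 hL']
    · simp; omega
    · exact hm'
    · intro v p hp; simp [P', hp]
    · intro v v' p h1 h2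
      simp only [Nat.add_sub_cancel] at h2
      simp [P', not_lt.2 h1, h2]
    · intro v hv x hx
      simp only [Nat.add_sub_cancel] at hx
      have := (hτ x x (hxτ v x hx) (hxτ v x hx) _ ⟨v, hv, rfl⟩).1
      rwa [hovx v x hx] at this
    · intro v hv x x' hx hx' hg hg'
      simp only [Nat.add_sub_cancel] at hx hx'
      have := (hτ x x' (hxτ v x hx) (hxτ v x' hx') _ ⟨v, hv, rfl⟩).2.1
      rw [hovx v x hx, hovx v x' hx'] at this
      exact this hg hg'
    · intro v hv v' hv' x x' hx hx' hxx hg hg' M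
      simp only [Nat.add_sub_cancel] at hx hx' hxx
      have := (hτ x x (hxτ v x hx) (hxτ v x hx) _ ⟨v, hv, rfl⟩).2.2 _ ⟨v', hv', rfl⟩
      have e : ov st.L (st.P v') x = x' := by
        rw [← hovx v' x' hx']
        ext p
        by_cases h : p < st.L
        · simp [ov, h]
        · simp only [ov, h, if_false]
          by_cases h2 : p < L'
          · rw [hxτ v x hx p (by omega) h2, hxτ v' x' hx' p (by omega) h2]
          · exact hxx p (by omega)
      rw [hovx v x hx, e] at this
      exact this hg hg' M
  choose! nx hnx1 hnx2 using hnext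
  let s : ℕ → St := fun i => Nat.rec ⟨1, 0, fun v _ => v 0⟩ (fun i st => nx i st) i
  have hs0 : s 0 = ⟨1, 0, fun v _ => v 0⟩ := rfl
  have hsS : ∀ i, s (i+1) = nx i (s i) := fun i => rfl
  have hInv : ∀ i, Inv i (s i) := by
    intro i
    induction i with
    | zero =>
      rw [hs0]
      refine ⟨le_rfl, ?_, ?_, ?_⟩
      · refine (((F 0).finite_toSet).image (fun a => fun _ : ℕ => a)).subset ?_
        rintro _ ⟨v, hv, rfl⟩
        exact ⟨v 0, hv 0, rfl⟩
      · intro v v' h; simp [h 0 le_rfl]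
      · intro v; rfl
    | succ i ih => rw [hsS]; exact hnx1 i _ ih
  have hR : ∀ i, R i (s i) (s (i+1)) := fun i => by rw [hsS]; exact hnx2 i _ (hInv i)
  have hLm : StrictMono fun i => (s i).L := strictMono_nat_of_lt_succ fun i => (hR i).1
  have hmm : StrictMono fun i => (s i).m := strictMono_nat_of_lt_succ fun i => (hR i).2.1
  have hLi : ∀ i, i < (s i).L := by
    intro i
    induction i with
    | zero => simp [hs0]
    | succ i ih => have := (hR i).1; omega
  let ι : (ℕ → ℕ) → (ℕ → ℕ) := fun v p => (s p).P v p
  have hPle : ∀ v i j, i ≤ j → ∀ p < (s i).L, (s j).P v p = (s i).P v p := by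
    intro v i j hij
    induction j, hij using Nat.le_induction with
    | base => intro p _; rfl
    | succ j hij ih =>
      intro p hp
      rw [(hR j).2.2.1 v p (lt_of_lt_of_le hp (hLm.monotone hij)), ih p hp]
  have hι : ∀ v i, ∀ p < (s i).L, ι v p = (s i).P v p := by
    intro v i p hp
    rcases le_total i p with h | h
    · exact hPle v i p h p hp
    · exact (hPle v p i h p (hLi p)).symm
  let n : ℕ → ℕ := fun i => (s i).L - 1
  have hn : StrictMono n := by
    intro i j hij
    have := hLm hij
    have h1 := (hInv i).1
    simp only [n] at this ⊢
    omega
  have hιn : ∀ v i, ι v (n i) = v i := by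
    intro v i
    rw [hι v i (n i) (by have := (hInv i).1; simp only [n]; omega)]
    exact (hInv i).2.2.2 v
  have hιc : ∀ p, p ∉ range n → ∀ v v', ι v p = ι v' p := by
    intro p hp v v'
    have hex : ∃ i, p < (s i).L := ⟨p, hLi p⟩
    have hlt := Nat.find_spec hex
    rcases h : Nat.find hex with _ | i
    · rw [h] at hlt
      exfalso; apply hp; refine ⟨0, ?_⟩
      simp [hs0] at hlt; simp [n, hs0, hlt]
    · rw [h] at hlt
      have hge : ¬ p < (s i).L := Nat.find_min hex (by omega)
      have hne : p ≠ n (i+1) := fun e => hp ⟨i+1, e.symm⟩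
      rw [hι v (i+1) p hlt, hι v' (i+1) p hlt]
      apply (hR i).2.2.2.1 v v' p (by omega)
      simp only [n] at hne; omega
  have hιG : ∀ v ∈ PF, ι v ∈ G := by
    intro v hv
    refine mem_iInter.2 fun i => ?_
    apply (hR i).2.2.2.2.1 v hv
    intro p hp
    exact hι v (i+1) p (by omega)
  refine ⟨ι, n, fun i => (s i).m, hn, hmm, rfl, hιn, hιc, ?_⟩
  intro v v' hv hv' i hi
  let w : ℕ → ℕ := fun j => if j ≤ i then v j else v' j
  have hw : w ∈ PF := by
    intro j
    simp only [w]; split_ifs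
    · exact hv j
    · exact hv' j
  have hwP : (s i).P w = (s i).P v := (hInv i).2.2.1 w v (fun j hj => by simp [w, hj])
  have b1 : ∑ k ∈ Finset.Ico (s i).m (s (i+1)).m, d (θ (ι v) k) (θ (ι w) k) ≤ (1/2)^(i+1) := by
    have := (hR i).2.2.2.2.2.1 v hv (ι v) (ι w) (fun p hp => hι v (i+1) p (by omega)) ?_
      (hιG v hv) (hιG w hw)
    · refine le_trans (Finset.sum_le_sum_of_subset_of_nonneg ?_ (fun k _ _ => hdn _ _)) this
      intro k hk; simp at hk ⊢; omega
    · intro p hp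
      rw [hι w (i+1) p (by omega)]
      by_cases h : p < (s i).L
      · rw [(hR i).2.2.1 w p h, (hR i).2.2.1 v p h, hwP]
      · exact (hR i).2.2.2.1 w v p (by omega) hp
  have b2 : ∑ k ∈ Finset.Ico (s i).m (s (i+1)).m, d (θ (ι w) k) (θ (ι v') k) ≤ (1/2)^i := by
    rcases i with _ | i
    · have : w = v' := by
        ext j
        simp only [w]
        split_ifs with h
        · have : j = 0 := by omega
          rw [this, hi]
        · rfl
      rw [this]; simp [hd0]
    · apply (hR i).2.2.2.2.2.2 w hw v' hv' (ι w) (ι v') (fun p hp => hι w (i+1) p (by omega))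
        (fun p hp => hι v' (i+1) p (by omega)) ?_ (hιG w hw) (hιG v' hv')
      intro p hp
      by_cases h : p ∈ range n
      · obtain ⟨j, rfl⟩ := h
        have hj : i + 1 ≤ j := hn.le_iff_le.1 hp
        rw [hιn, hιn]
        simp only [w]
        split_ifs with h
        · have : j = i + 1 := by omega
          rw [this, hi]
        · rfl
      · exact hιc p h _ _
  calc ∑ k ∈ Finset.Ico (s i).m (s (i+1)).m, d (θ (ι v) k) (θ (ι v') k)
      ≤ ∑ k ∈ Finset.Ico (s i).m (s (i+1)).m, K * (d (θ (ι v) k) (θ (ι w) k) + d (θ (ι w) k) (θ (ι v') k)) :=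
        Finset.sum_le_sum fun k _ => htri _ _ _
    _ = K * (∑ k ∈ Finset.Ico (s i).m (s (i+1)).m, d (θ (ι v) k) (θ (ι w) k) +
          ∑ k ∈ Finset.Ico (s i).m (s (i+1)).m, d (θ (ι w) k) (θ (ι v') k)) := by
        rw [← Finset.mul_sum, Finset.sum_add_distrib]
    _ ≤ K * (2 * (1/2)^i) := by
        apply mul_le_mul_of_nonneg_left _ hK
        have : (1/2:ℝ)^(i+1) ≤ (1/2)^i := by
          rw [pow_succ]; have : (0:ℝ) ≤ (1/2)^i := by positivity
          linarith
        linarith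

theorem summable_blocks (h : ℕ → ℝ) (hh : ∀ k, 0 ≤ h k) (m : ℕ → ℕ) (hm : StrictMono m) (hm0 : m 0 = 0) :
    Summable h ↔ Summable fun i => ∑ k ∈ Finset.Ico (m i) (m (i+1)), h k := by
  have key : ∀ n, ∑ i ∈ Finset.range n, ∑ k ∈ Finset.Ico (m i) (m (i+1)), h k
      = ∑ k ∈ Finset.range (m n), h k := by
    intro n
    induction n with
    | zero => simp [hm0]
    | succ n ih =>
      rw [Finset.sum_range_succ, ih, Finset.range_eq_Ico, Finset.sum_Ico_consecutive _ (Nat.zero_le _)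
        (hm.monotone (Nat.le_succ n)), Finset.range_eq_Ico]
  have hbn : ∀ i, 0 ≤ ∑ k ∈ Finset.Ico (m i) (m (i+1)), h k :=
    fun i => Finset.sum_nonneg fun k _ => hh k
  constructor
  · intro hs
    refine summable_of_sum_range_le (c := ∑' k, h k) hbn fun n => ?_
    rw [key]
    exact hs.sum_le_tsum _ (fun k _ => hh k)
  · intro hs
    refine summable_of_sum_range_le (c := ∑' i, ∑ k ∈ Finset.Ico (m i) (m (i+1)), h k) hh fun n => ?_
    refine le_trans ?_ (hs.sum_le_tsum (Finset.range n) (fun k _ => hbn k))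
    rw [key]
    refine Finset.sum_le_sum_of_subset_of_nonneg ?_ (fun k _ _ => hh k)
    exact Finset.range_subset_range.2 (hm.le_apply)

theorem modular2 {Y : Type*} [TopologicalSpace Y] (θ : (ℕ → ℕ) → (ℕ → Y)) (d : Y → Y → ℝ)
    (hd : Continuous fun p : Y × Y => d p.1 p.2) (hd0 : ∀ a, d a a = 0) (hdn : ∀ a b, 0 ≤ d a b)
    (K : ℝ) (hK : 0 ≤ K) (htri : ∀ a b c, d a c ≤ K * (d a b + d b c))
    (D : ℕ → Set (ℕ → ℕ)) (hDo : ∀ i, IsOpen (D i)) (hDd : ∀ i, Dense (D i))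
    (hc : ContinuousOn θ (⋂ i, D i))
    (hfin : ∀ x y : ℕ → ℕ, (∃ L, ∀ p ≥ L, x p = y p) → Summable fun k => d (θ x k) (θ y k))
    (F : ℕ → Finset ℕ) (hF : ∀ j, (F j).Nonempty) :
    ∃ (ι : (ℕ → ℕ) → (ℕ → ℕ)) (n : ℕ → ℕ) (T : ℕ → Finset ℕ) (y : ℕ → ℕ → ℕ → Y),
      Function.Injective n ∧
      (∀ v i, ι v (n i) = v i) ∧ (∀ p, p ∉ range n → ∀ v v', ι v p = ι v' p) ∧
      ∀ v v', (∀ j, v j ∈ F j) → (∀ j, v' j ∈ F j) →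
        ((Summable fun k => d (θ (ι v) k) (θ (ι v') k)) ↔
          Summable fun j => ∑ k ∈ T j, d (y j (v j) k) (y j (v' j) k)) := by
  classical
  obtain ⟨ι, n, m, hn, hm, hm0, hιn, hιc, hb⟩ := modular θ d hd hd0 hdn K hK htri D hDo hDd hc hfin F
  choose v0 hv0 using hF
  let up : ℕ → ℕ → (ℕ → ℕ) := fun j a => Function.update v0 j a
  have hup : ∀ v : ℕ → ℕ, (∀ j, v j ∈ F j) → ∀ j i, up j (v j) i ∈ F i := by
    intro v hv j i
    simp only [up]
    by_cases h : i = j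
    · subst h; simpa using hv i
    · simpa [h] using hv0 i
  let T : ℕ → Finset ℕ := fun i => Finset.Ico (m i) (m (i+1))
  refine ⟨ι, n, T, fun j a k => θ (ι (up j a)) k, hn.injective, hιn, hιc, ?_⟩
  intro v v' hv hv'
  rw [summable_blocks _ (fun k => hdn _ _) m hm hm0]
  have htri4 : ∀ (i : ℕ) (x1 x2 x3 x4 : ℕ → Y), ∑ k ∈ T i, d (x1 k) (x4 k) ≤
      K * (∑ k ∈ T i, d (x1 k) (x2 k) + K * (∑ k ∈ T i, d (x2 k) (x3 k) + ∑ k ∈ T i, d (x3 k) (x4 k))) := by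
    intro i x1 x2 x3 x4
    rw [← Finset.sum_add_distrib, Finset.mul_sum, ← Finset.sum_add_distrib, Finset.mul_sum]
    refine Finset.sum_le_sum fun k _ => ?_
    refine (htri _ (x2 k) _).trans (mul_le_mul_of_nonneg_left ?_ hK)
    exact add_le_add_right (htri _ (x3 k) _) _
  have hgeo : Summable fun i : ℕ => K * (2 * (1/2:ℝ)^i) :=
    (summable_geometric_two.mul_left 2).mul_left K
  have e1 : ∀ i, ∑ k ∈ T i, d (θ (ι v) k) (θ (ι (up i (v i))) k) ≤ K * (2 * (1/2)^i) :=
    fun i => hb _ _ hv (hup v hv i) i (by simp [up])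
  have e1' : ∀ i, ∑ k ∈ T i, d (θ (ι (up i (v i))) k) (θ (ι v) k) ≤ K * (2 * (1/2)^i) :=
    fun i => hb _ _ (hup v hv i) hv i (by simp [up])
  have e2 : ∀ i, ∑ k ∈ T i, d (θ (ι v') k) (θ (ι (up i (v' i))) k) ≤ K * (2 * (1/2)^i) :=
    fun i => hb _ _ hv' (hup v' hv' i) i (by simp [up])
  have e2' : ∀ i, ∑ k ∈ T i, d (θ (ι (up i (v' i))) k) (θ (ι v') k) ≤ K * (2 * (1/2)^i) :=
    fun i => hb _ _ (hup v' hv' i) hv' i (by simp [up])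
  constructor
  · intro hs
    refine Summable.of_nonneg_of_le (fun i => Finset.sum_nonneg fun k _ => hdn _ _) (fun i => ?_)
      ((hgeo.add ((hs.add hgeo).mul_left K)).mul_left K)
    refine (htri4 i _ (θ (ι v)) (θ (ι v')) _).trans ?_
    refine mul_le_mul_of_nonneg_left (add_le_add (e1' i) ?_) hK
    exact mul_le_mul_of_nonneg_left (add_le_add_right (e2 i) _) hK
  · intro hs
    refine Summable.of_nonneg_of_le (fun i => Finset.sum_nonneg fun k _ => hdn _ _) (fun i => ?_)
      ((hgeo.add ((hs.add hgeo).mul_left K)).mul_left K)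
    refine (htri4 i _ (θ (ι (up i (v i)))) (θ (ι (up i (v' i)))) _).trans ?_
    refine mul_le_mul_of_nonneg_left (add_le_add (e1 i) ?_) hK
    exact mul_le_mul_of_nonneg_left (add_le_add_right (e2' i) _) hK



/-- key chain inequality -/
theorem chain (α : ℝ) (hα : 1 ≤ α) (ψ : ℝ → ℝ) (C lam : ℝ) (hC : 1 ≤ C) (hlam : 0 < lam)
    (hinc : ∀ x ∈ Icc (0:ℝ) 1, ∀ y ∈ Icc (0:ℝ) 1, x ≤ y → ψ x ≤ C * ψ y)
    (hnn : ∀ t ∈ Icc (0:ℝ) 1, 0 ≤ ψ t) (hpos : ∀ t ∈ Ioc (0:ℝ) 1, 0 < ψ t)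
    (hsq : ∀ t ∈ Icc (0:ℝ) 1, lam * ψ t ≤ ψ (t^2)) :
    ∃ B > 0, ∀ N : ℕ, 2 ≤ N → ∀ y : ℕ → ℝ, (∀ i, y i ∈ Icc (0:ℝ) 1) →
      |y 0 - y N| ^ α * ψ |y 0 - y N| ≤ B * (N:ℝ)^(α - 1) / ψ (1/N) *
        ∑ i ∈ Finset.range N, |y i - y (i+1)| ^ α * ψ |y i - y (i+1)| := by
  have hψ1 : 0 < ψ 1 := hpos 1 (by norm_num)
  have hCpos : 0 < C := by linarith
  -- κ ψ(Y) ψ(1/N) ≤ ψ(Y/(2N))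
  obtain ⟨κ, hκ, hκψ⟩ : ∃ κ > 0, ∀ N : ℕ, 2 ≤ N → ∀ Y ∈ Ioc (0:ℝ) 1,
      κ * (ψ Y * ψ (1/N)) ≤ ψ (Y/(2*N)) := by
    refine ⟨min (lam^2 / (C^2 * ψ 1)) (lam / (C^2 * ψ 1)), by positivity, ?_⟩
    intro N hN Y hY
    have hN' : (2:ℝ) ≤ N := by exact_mod_cast hN
    have hNpos : (0:ℝ) < N := by linarith
    have h1N : (1/N:ℝ) ∈ Icc (0:ℝ) 1 := ⟨by positivity, by rw [div_le_one hNpos]; linarith⟩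
    have hYI : Y ∈ Icc (0:ℝ) 1 := ⟨hY.1.le, hY.2⟩
    have hq : Y/(2*N) ∈ Icc (0:ℝ) 1 := by
      refine ⟨by have := hY.1; positivity, ?_⟩
      rw [div_le_one (by positivity)]; linarith [hY.2]
    have one : (1:ℝ) ∈ Icc (0:ℝ) 1 := by norm_num
    have hψY := hinc Y hYI 1 one hY.2
    have hψN := hinc _ h1N 1 one h1N.2
    have hY0 := hnn Y hYI
    have hN0 := hnn _ h1N
    rcases le_total (1/(2*N:ℝ)) Y with h | h
    · have a1 : ((1/N:ℝ)^2)^2 ≤ Y/(2*N) := by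
        have : 1/(2*N:ℝ) * (1/(2*N)) ≤ Y * (1/(2*N)) :=
          mul_le_mul_of_nonneg_right h (by positivity)
        have e : Y/(2*N) = Y * (1/(2*N)) := by ring
        rw [e]
        refine le_trans ?_ this
        have e3 : (1/N:ℝ)^2 ≤ 1/4 := by
          rw [div_pow, one_pow]
          apply one_div_le_one_div_of_le (by norm_num); nlinarith
        have e4 : 1/(2*N:ℝ) * (1/(2*N)) = (1/N)^2 * (1/4) := by field_simp; norm_num
        rw [e4, sq ((1/N:ℝ)^2)]
        exact mul_le_mul_of_nonneg_left e3 (by positivity)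
      have hs1 : (1/N:ℝ)^2 ∈ Icc (0:ℝ) 1 := ⟨by positivity, pow_le_one₀ h1N.1 h1N.2⟩
      have hs2 : ((1/N:ℝ)^2)^2 ∈ Icc (0:ℝ) 1 := ⟨by positivity, pow_le_one₀ hs1.1 hs1.2⟩
      have b1 := hsq _ h1N
      have b2 := hsq _ hs1
      have b3 := hinc _ hs2 _ hq a1
      have b4 : lam * (lam * ψ (1/N)) ≤ C * ψ (Y/(2*N)) :=
        (mul_le_mul_of_nonneg_left b1 hlam.le).trans (b2.trans b3)
      calc _ ≤ (lam^2 / (C^2 * ψ 1)) * (ψ Y * ψ (1/N)) :=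
            mul_le_mul_of_nonneg_right (min_le_left _ _) (mul_nonneg hY0 hN0)
        _ ≤ (lam^2 / (C^2 * ψ 1)) * (C * ψ 1 * ψ (1/N)) := by gcongr
        _ = (lam * (lam * ψ (1/N))) / C := by field_simp
        _ ≤ ψ (Y/(2*N)) := by rw [div_le_iff₀ hCpos]; linarith
    · have a1 : Y^2 ≤ Y/(2*N) := by
        have e : Y/(2*N) = Y * (1/(2*N)) := by ring
        rw [e, sq]; exact mul_le_mul_of_nonneg_left h hY.1.le
      have hs1 : Y^2 ∈ Icc (0:ℝ) 1 := ⟨by positivity, pow_le_one₀ hYI.1 hYI.2⟩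
      have b1 := hsq _ hYI
      have b3 := hinc _ hs1 _ hq a1
      calc _ ≤ (lam / (C^2 * ψ 1)) * (ψ Y * ψ (1/N)) :=
            mul_le_mul_of_nonneg_right (min_le_right _ _) (mul_nonneg hY0 hN0)
        _ ≤ (lam / (C^2 * ψ 1)) * (ψ Y * (C * ψ 1)) := by gcongr
        _ = (lam * ψ Y) / C := by field_simp
        _ ≤ ψ (Y/(2*N)) := by rw [div_le_iff₀ hCpos]; linarith
  refine ⟨2^α * C / κ, by positivity, ?_⟩
  intro N hN y hy
  have hN' : (2:ℝ) ≤ N := by exact_mod_cast hN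
  have hNpos : (0:ℝ) < N := by linarith
  have h1N : (1/N:ℝ) ∈ Ioc (0:ℝ) 1 := ⟨by positivity, by rw [div_le_one hNpos]; linarith⟩
  have hψN := hpos _ h1N
  have hab : ∀ i j, |y i - y j| ∈ Icc (0:ℝ) 1 := by
    intro i j
    refine ⟨abs_nonneg _, ?_⟩
    rw [abs_le]; have := hy i; have := hy j; simp only [mem_Icc] at *; constructor <;> linarith
  have hterm : ∀ i, 0 ≤ |y i - y (i+1)| ^ α * ψ |y i - y (i+1)| := fun i =>
    mul_nonneg (Real.rpow_nonneg (abs_nonneg _) _) (hnn _ (hab _ _))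
  set Y := |y 0 - y N| with hYdef
  rcases (abs_nonneg (y 0 - y N)).eq_or_lt with h0 | h0
  · rw [← hYdef] at h0
    rw [← h0, Real.zero_rpow (by linarith), zero_mul]
    exact mul_nonneg (by positivity) (Finset.sum_nonneg fun i _ => hterm i)
  rw [← hYdef] at h0
  have hY : Y ∈ Ioc (0:ℝ) 1 := ⟨h0, (hab 0 N).2⟩
  set T := (Finset.range N).filter fun i => Y/(2*N) ≤ |y i - y (i+1)| with hT
  have hsumd : Y ≤ ∑ i ∈ Finset.range N, |y i - y (i+1)| := by
    rw [hYdef, ← Finset.sum_range_sub' y N]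
    exact Finset.abs_sum_le_sum_abs _ _
  have hTsum : Y/2 ≤ ∑ i ∈ T, |y i - y (i+1)| := by
    have hsplit := Finset.sum_filter_add_sum_filter_not (Finset.range N)
      (fun i => Y/(2*N) ≤ |y i - y (i+1)|) (fun i => |y i - y (i+1)|)
    have hsmall : ∑ i ∈ (Finset.range N).filter (fun i => ¬ Y/(2*N) ≤ |y i - y (i+1)|), |y i - y (i+1)|
        ≤ Y/2 := by
      calc _ ≤ ∑ i ∈ (Finset.range N).filter (fun i => ¬ Y/(2*N) ≤ |y i - y (i+1)|), Y/(2*N) := by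
            refine Finset.sum_le_sum fun i hi => ?_
            exact (not_le.1 (Finset.mem_filter.1 hi).2).le
        _ ≤ ∑ i ∈ Finset.range N, Y/(2*N) := by
            refine Finset.sum_le_sum_of_subset_of_nonneg (Finset.filter_subset _ _) fun i _ _ => ?_
            positivity
        _ = Y/2 := by simp; field_simp
    linarith
  have hpow : (Y/2)^α ≤ (N:ℝ)^(α-1) * ∑ i ∈ T, |y i - y (i+1)|^α := by
    calc (Y/2)^α ≤ (∑ i ∈ T, |y i - y (i+1)|)^α :=
          Real.rpow_le_rpow (by positivity) hTsum (by linarith)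
      _ ≤ (T.card:ℝ)^(α-1) * ∑ i ∈ T, |y i - y (i+1)|^α :=
          Real.rpow_sum_le_const_mul_sum_rpow_of_nonneg T hα (fun i _ => abs_nonneg _)
      _ ≤ _ := by
          refine mul_le_mul_of_nonneg_right ?_ (Finset.sum_nonneg fun i _ => Real.rpow_nonneg (abs_nonneg _) _)
          refine Real.rpow_le_rpow (by positivity) ?_ (by linarith)
          have := Finset.card_filter_le (Finset.range N) fun i => Y/(2*N) ≤ |y i - y (i+1)|
          rw [Finset.card_range] at this
          exact Nat.cast_le.2 this
  have hq : Y/(2*N) ∈ Icc (0:ℝ) 1 := by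
    refine ⟨by have := hY.1; positivity, ?_⟩
    rw [div_le_one (by positivity)]; linarith [hY.2]
  have hlow : ψ (Y/(2*N)) * ∑ i ∈ T, |y i - y (i+1)|^α ≤
      C * ∑ i ∈ Finset.range N, |y i - y (i+1)| ^ α * ψ |y i - y (i+1)| := by
    calc _ = ∑ i ∈ T, |y i - y (i+1)|^α * ψ (Y/(2*N)) := by
          rw [Finset.mul_sum]; exact Finset.sum_congr rfl fun i _ => mul_comm _ _
      _ ≤ ∑ i ∈ T, C * (|y i - y (i+1)|^α * ψ |y i - y (i+1)|) := by
          refine Finset.sum_le_sum fun i hi => ?_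
          have := hinc _ hq _ (hab i (i+1)) (Finset.mem_filter.1 hi).2
          calc _ ≤ |y i - y (i+1)|^α * (C * ψ |y i - y (i+1)|) :=
                mul_le_mul_of_nonneg_left this (Real.rpow_nonneg (abs_nonneg _) _)
            _ = _ := by ring
      _ ≤ ∑ i ∈ Finset.range N, C * (|y i - y (i+1)|^α * ψ |y i - y (i+1)|) :=
          Finset.sum_le_sum_of_subset_of_nonneg (Finset.filter_subset _ _)
            fun i _ _ => mul_nonneg hCpos.le (hterm i)
      _ = _ := by rw [Finset.mul_sum]
  have hk := hκψ N hN Y hY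
  set S := ∑ i ∈ Finset.range N, |y i - y (i+1)| ^ α * ψ |y i - y (i+1)| with hS
  set Q := ∑ i ∈ T, |y i - y (i+1)|^α with hQ
  have hQ0 : 0 ≤ Q := Finset.sum_nonneg fun i _ => Real.rpow_nonneg (abs_nonneg _) _
  have hYpow : Y^α = 2^α * (Y/2)^α := by
    rw [← Real.mul_rpow (by norm_num) (by positivity)]; congr 1; ring
  have hNp : 0 ≤ (N:ℝ)^(α-1) := by positivity
  have fin : Y^α * ψ Y * (κ * ψ (1/N)) ≤ 2^α * C * (N:ℝ)^(α-1) * S := by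
    calc _ = Y^α * (κ * (ψ Y * ψ (1/N))) := by ring
      _ ≤ Y^α * ψ (Y/(2*N)) := mul_le_mul_of_nonneg_left hk (by positivity)
      _ = 2^α * ψ (Y/(2*N)) * (Y/2)^α := by rw [hYpow]; ring
      _ ≤ 2^α * ψ (Y/(2*N)) * ((N:ℝ)^(α-1) * Q) :=
          mul_le_mul_of_nonneg_left hpow (mul_nonneg (by positivity) (hnn _ hq))
      _ = 2^α * (N:ℝ)^(α-1) * (ψ (Y/(2*N)) * Q) := by ring
      _ ≤ 2^α * (N:ℝ)^(α-1) * (C * S) := mul_le_mul_of_nonneg_left hlow (by positivity)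
      _ = _ := by ring
  calc Y^α * ψ Y = Y^α * ψ Y * (κ * ψ (1/N)) / (κ * ψ (1/N)) := by field_simp
    _ ≤ 2^α * C * (N:ℝ)^(α-1) * S / (κ * ψ (1/N)) := by gcongr
    _ = _ := by field_simp


noncomputable def ecode (q : ℕ) : Icc (0:ℝ) 1 :=
  projIcc 0 1 zero_le_one ((q.unpair.2 : ℝ) / 2 ^ q.unpair.1)

theorem ecode_pair (n i : ℕ) (h : i ≤ 2^n) : (ecode (Nat.pair n i) : ℝ) = i / 2^n := by
  unfold ecode
  rw [Nat.unpair_pair]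
  have : ((i:ℝ) / 2^n) ∈ Icc (0:ℝ) 1 := by
    refine ⟨by positivity, ?_⟩
    rw [div_le_one (by positivity)]; exact_mod_cast h
  simp only
  rw [projIcc_of_mem zero_le_one this]

/-- Main non-reducibility criterion. -/
theorem core (α : ℝ) (hα : 1 ≤ α) (f ψ : ℝ → ℝ) (C lam A : ℝ) (hC : 1 ≤ C) (hlam : 0 < lam)
    (hinc : ∀ x ∈ Icc (0:ℝ) 1, ∀ y ∈ Icc (0:ℝ) 1, x ≤ y → ψ x ≤ C * ψ y)
    (hnn : ∀ t ∈ Icc (0:ℝ) 1, 0 ≤ ψ t) (hpos : ∀ t ∈ Ioc (0:ℝ) 1, 0 < ψ t)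
    (hsq : ∀ t ∈ Icc (0:ℝ) 1, lam * ψ t ≤ ψ (t^2))
    (hψc : ContinuousOn ψ (Icc 0 1))
    (hf0 : f 0 = 0) (hf1 : 0 < f 1)
    (n : ℕ → ℕ) (hn : ∀ r, 1 ≤ n r) (hfn : ∀ r, 0 < f (1/2^(n r))) (hA : 0 ≤ A)
    (hfA : ∀ r, f (1/2^(n r)) ≤ A * (1/2)^r)
    (hratio : ∀ r, f (1/2^(n r)) * ((2:ℝ)^(n r))^α / ψ (1/2^(n r)) ≤ A * (1/4)^r)
    (hred : BorelReducible (EF f) (EF fun t => t ^ α * ψ t)) : False := by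
  classical
  obtain ⟨θ, hθ, hθr⟩ := hred
  obtain ⟨B, hB, hchain⟩ := chain α hα ψ C lam hC hlam hinc hnn hpos hsq
  let d : Icc (0:ℝ) 1 → Icc (0:ℝ) 1 → ℝ := fun a b => |(a:ℝ) - b| ^ α * ψ |(a:ℝ) - b|
  have hab : ∀ a b : Icc (0:ℝ) 1, |(a:ℝ) - b| ∈ Icc (0:ℝ) 1 := by
    intro a b
    refine ⟨abs_nonneg _, ?_⟩
    rw [abs_le]; have := a.2; have := b.2; simp only [mem_Icc] at *; constructor <;> linarith
  have hd : Continuous fun p : Icc (0:ℝ) 1 × Icc (0:ℝ) 1 => d p.1 p.2 := by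
    have h1 : Continuous fun p : Icc (0:ℝ) 1 × Icc (0:ℝ) 1 => |(p.1:ℝ) - p.2| := by fun_prop
    refine (h1.rpow_const fun _ => Or.inr (by linarith)).mul ?_
    exact hψc.comp_continuous h1 fun p => hab _ _
  have hd0 : ∀ a, d a a = 0 := by
    intro a; simp only [d, sub_self, abs_zero]; rw [Real.zero_rpow (by linarith), zero_mul]
  have hdn : ∀ a b, 0 ≤ d a b := fun a b =>
    mul_nonneg (Real.rpow_nonneg (abs_nonneg _) _) (hnn _ (hab _ _))
  obtain ⟨K, hK, htri⟩ : ∃ K : ℝ, 0 ≤ K ∧ ∀ a b c, d a c ≤ K * (d a b + d b c) := by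
    refine ⟨B * ((2:ℕ):ℝ)^(α-1) / ψ (1/(2:ℕ)), ?_, ?_⟩
    · have := hpos (1/(2:ℕ)) (by norm_num)
      positivity
    · intro a b c
      have := hchain 2 le_rfl (fun i => if i = 0 then (a:ℝ) else if i = 1 then (b:ℝ) else c) (by
        intro i; split_ifs
        · exact a.2
        · exact b.2
        · exact c.2)
      simpa [Finset.sum_range_succ, d] using this
  let Θ : (ℕ → ℕ) → (ℕ → Icc (0:ℝ) 1) := fun x => θ fun p => ecode (x p)
  have hΘ : Measurable Θ := by
    refine hθ.comp (measurable_pi_lambda _ fun p => ?_)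
    exact (measurable_of_countable ecode).comp (measurable_pi_apply p)
  have hΘr : ∀ x x', (Summable fun p => f |(ecode (x p):ℝ) - ecode (x' p)|) ↔
      Summable fun k => d (Θ x k) (Θ x' k) := fun x x' => hθr _ _
  obtain ⟨D, hDo, hDd, hc⟩ := exists_contOn Θ hΘ
  have hfin : ∀ x y : ℕ → ℕ, (∃ L, ∀ p ≥ L, x p = y p) → Summable fun k => d (Θ x k) (Θ y k) := by
    rintro x y ⟨L, hL⟩
    rw [← hΘr]
    refine summable_of_ne_finset_zero (s := Finset.range L) fun p hp => ?_
    rw [hL p (by simpa using hp)]; simp [hf0]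
  let rr : ℕ → ℕ := fun j => j.unpair.1
  let N : ℕ → ℕ := fun r => 2 ^ n r
  let x : ℕ → ℕ → ℕ := fun r i => Nat.pair (n r) i
  let F : ℕ → Finset ℕ := fun j => (Finset.range (N (rr j) + 1)).image (x (rr j))
  have hxF : ∀ j i, i ≤ N (rr j) → x (rr j) i ∈ F j := by
    intro j i hi
    exact Finset.mem_image.2 ⟨i, by simp; omega, rfl⟩
  obtain ⟨ι, ν, T, y, hν, hιν, hιc, hmod⟩ := modular2 Θ d hd hd0 hdn K hK htri D hDo hDd hc hfin F
    (fun j => ⟨_, hxF j 0 (Nat.zero_le _)⟩)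
  let c : ℕ → ℕ → ℕ → ℝ := fun j a b => ∑ k ∈ T j, d (y j a k) (y j b k)
  have hcn : ∀ j a b, 0 ≤ c j a b := fun j a b => Finset.sum_nonneg fun k _ => hdn _ _
  have hc0 : ∀ j a, c j a a = 0 := fun j a => Finset.sum_eq_zero fun k _ => hd0 _
  have main : ∀ v v' : ℕ → ℕ, (∀ j, v j ∈ F j) → (∀ j, v' j ∈ F j) →
      ((Summable fun j => f |(ecode (v j):ℝ) - ecode (v' j)|) ↔
        Summable fun j => c j (v j) (v' j)) := by
    intro v v' hv hv'
    rw [← hmod v v' hv hv', ← hΘr]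
    rw [← hν.summable_iff (f := fun p => f |(ecode (ι v p):ℝ) - ecode (ι v' p)|)]
    · simp only [Function.comp_def, hιν]
    · intro p hp
      rw [hιc p hp v v']; simp [hf0]
  have hex : ∀ r i, i ≤ N r → (ecode (x r i) : ℝ) = i / 2 ^ n r := fun r i hi => ecode_pair _ _ hi
  let fr : ℕ → ℝ := fun r => f (1/2^(n r))
  -- Claim 1
  have claim1 : ∃ r0, ∀ r ≥ r0, ∃ j, rr j = r ∧
      ∀ i < N r, c j (x r i) (x r (i+1)) ≤ 2^r * fr r := by
    by_contra hcon
    push Not at hcon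
    let R : Set ℕ := {r | ∀ j, rr j = r → ∃ i < N r, 2^r * fr r < c j (x r i) (x r (i+1))}
    have hRinf : ∀ r0, ∃ r ≥ r0, r ∈ R := hcon
    have hch : ∀ j, ∃ i, rr j ∈ R → i < N (rr j) ∧
        2^(rr j) * fr (rr j) < c j (x (rr j) i) (x (rr j) (i+1)) := by
      intro j
      by_cases h : rr j ∈ R
      · obtain ⟨i, hi⟩ := h j rfl
        exact ⟨i, fun _ => hi⟩
      · exact ⟨0, fun h' => absurd h' h⟩
    choose I hI using hch
    let M : ℕ → ℕ := fun r => ⌈(1/2:ℝ)^r / fr r⌉₊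
    let Cd : ℕ → Prop := fun j => rr j ∈ R ∧ j.unpair.2 < M (rr j)
    let v : ℕ → ℕ := fun j => if Cd j then x (rr j) (I j) else x (rr j) 0
    let v' : ℕ → ℕ := fun j => if Cd j then x (rr j) (I j + 1) else x (rr j) 0
    have hv : ∀ j, v j ∈ F j := by
      intro j
      simp only [v]; split_ifs with h
      · exact hxF j _ (hI j h.1).1.le
      · exact hxF j _ (Nat.zero_le _)
    have hv' : ∀ j, v' j ∈ F j := by
      intro j
      simp only [v']; split_ifs with h
      · exact hxF j _ (hI j h.1).1
      · exact hxF j _ (Nat.zero_le _)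
    have hpair : ∀ w : ℕ → ℝ, (∀ r, 0 ≤ w r) →
        ((Summable fun j => if Cd j then w (rr j) else 0) ↔
          Summable fun r => if r ∈ R then (M r : ℝ) * w r else 0) := by
      intro w hw
      rw [← Nat.pairEquiv.summable_iff, summable_prod_of_nonneg]
      · have e : ∀ r i, ((fun j => if Cd j then w (rr j) else 0) ∘ Nat.pairEquiv) (r, i)
            = if r ∈ R ∧ i < M r then w r else 0 := by
          intro r i
          have hp : Nat.pairEquiv (r, i) = Nat.pair r i := rfl
          simp only [Function.comp, hp, Cd, rr, Nat.unpair_pair]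
        have hz : ∀ r, ∀ i ∉ Finset.range (M r), (if r ∈ R ∧ i < M r then w r else 0) = 0 := by
          intro r i hi
          rw [if_neg]
          simp at hi; omega
        simp only [e]
        have e2 : ∀ r, ∑' i, (if r ∈ R ∧ i < M r then w r else 0) = if r ∈ R then (M r : ℝ) * w r else 0 := by
          intro r
          rw [tsum_eq_sum (hz r)]
          by_cases h : r ∈ R
          · simp only [h, true_and, if_true]
            rw [Finset.sum_congr rfl (g := fun _ => w r)]
            · simp
            · intro i hi; rw [if_pos (Finset.mem_range.1 hi)]
          · simp [h]
        simp only [e2]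
        constructor
        · exact fun h => h.2
        · exact fun h => ⟨fun r => summable_of_ne_finset_zero (hz r), h⟩
      · intro p
        simp only [Function.comp, Pi.zero_apply]
        split_ifs
        · exact hw _
        · exact le_rfl
    have hMlow : ∀ r, (1/2:ℝ)^r ≤ M r * fr r := by
      intro r
      have := Nat.le_ceil ((1/2:ℝ)^r / fr r)
      rwa [div_le_iff₀ (hfn r)] at this
    have hMup : ∀ r, M r * fr r ≤ (1 + A) * (1/2:ℝ)^r := by
      intro r
      have h1 := Nat.ceil_lt_add_one (a := (1/2:ℝ)^r / fr r) (div_nonneg (by positivity) (hfn r).le)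
      have h2 : (M r : ℝ) * fr r ≤ ((1/2:ℝ)^r / fr r + 1) * fr r :=
        mul_le_mul_of_nonneg_right h1.le (hfn r).le
      have h3 : ((1/2:ℝ)^r / fr r + 1) * fr r = (1/2:ℝ)^r + fr r := by
        rw [add_mul, div_mul_cancel₀ _ (hfn r).ne', one_mul]
      have := hfA r
      simp only [fr] at *
      linarith
    have s1 : Summable fun j => f |(ecode (v j):ℝ) - ecode (v' j)| := by
      have : (fun j => f |(ecode (v j):ℝ) - ecode (v' j)|) = fun j => if Cd j then fr (rr j) else 0 := by
        ext j
        simp only [v, v']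
        split_ifs with h
        · rw [hex _ _ (hI j h.1).1.le, hex _ _ (hI j h.1).1]
          simp only [fr]
          congr 1
          rw [← sub_div, abs_div]
          push_cast
          rw [sub_add_cancel_left, abs_neg, abs_one, abs_of_pos (by positivity)]
        · simp [hf0]
      rw [this, hpair _ (fun r => (hfn r).le)]
      refine Summable.of_nonneg_of_le (fun r => ?_) (fun r => ?_)
        (summable_geometric_two.mul_left (1 + A))
      · split_ifs
        · exact mul_nonneg (by positivity) (hfn r).le
        · exact le_rfl
      · split_ifs
        · exact hMup r
        · positivity
    have s2 := (main v v' hv hv').1 s1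
    have s3 : Summable fun j => if Cd j then (fun r => 2^r * fr r) (rr j) else 0 := by
      refine Summable.of_nonneg_of_le (fun j => ?_) (fun j => ?_) s2
      · split_ifs
        · exact mul_nonneg (by positivity) (hfn _).le
        · exact le_rfl
      · simp only [v, v']
        split_ifs with h
        · exact (hI j h.1).2.le
        · exact hcn _ _ _
    rw [hpair _ (fun r => mul_nonneg (by positivity) (hfn r).le)] at s3
    have t0 := s3.tendsto_atTop_zero
    have ev := t0.eventually (Iio_mem_nhds (zero_lt_one))
    obtain ⟨r0, hr0⟩ := Filter.eventually_atTop.1 ev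
    obtain ⟨r, hr, hrR⟩ := hRinf r0
    have := hr0 r hr
    rw [if_pos hrR] at this
    have l1 : (1:ℝ) ≤ M r * (2^r * fr r) := by
      have h := mul_le_mul_of_nonneg_left (hMlow r) (by positivity : (0:ℝ) ≤ 2^r)
      rw [← mul_pow] at h
      norm_num at h
      linarith
    exact absurd this (not_lt.2 l1)
  obtain ⟨r0, hr0⟩ := claim1
  have hr0' : ∀ r, ∃ j, rr j = r0 + r ∧
      ∀ i < N (r0+r), c j (x (r0+r) i) (x (r0+r) (i+1)) ≤ 2^(r0+r) * fr (r0+r) :=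
    fun r => hr0 (r0+r) (by omega)
  choose jj hjj hgood using hr0'
  have hjinj : Function.Injective jj := by
    intro r r' h
    have := hjj r
    rw [h, hjj r'] at this
    omega
  let v : ℕ → ℕ := fun j => x (rr j) 0
  let v' : ℕ → ℕ := fun j => if j ∈ range jj then x (rr j) (N (rr j)) else x (rr j) 0
  have hv : ∀ j, v j ∈ F j := fun j => hxF j 0 (Nat.zero_le _)
  have hv' : ∀ j, v' j ∈ F j := by
    intro j
    simp only [v']; split_ifs with h
    · exact hxF j _ le_rfl
    · exact hxF j _ (Nat.zero_le _)
  have hbound : ∀ r, c (jj r) (v (jj r)) (v' (jj r)) ≤ B * A * (1/2)^r := by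
    intro r
    have e1 : v' (jj r) = x (r0+r) (N (r0+r)) := by simp [v', hjj]
    have e2 : v (jj r) = x (r0+r) 0 := by simp [v, hjj]
    rw [e1, e2]
    set s := r0 + r with hs
    have hN2 : 2 ≤ N s := by
      calc 2 = 2^1 := rfl
        _ ≤ 2^(n s) := Nat.pow_le_pow_right (by norm_num) (hn s)
    have hNpos : (0:ℝ) < N s := by positivity
    have hNc : ((N s : ℕ):ℝ) = 2^(n s) := by simp [N]
    have hψp : 0 < ψ (1/(N s)) := hpos _ ⟨by positivity, by
      rw [div_le_one hNpos]; exact_mod_cast (by omega : 1 ≤ N s)⟩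
    have h1 : c (jj r) (x s 0) (x s (N s)) ≤ B * (N s:ℝ)^(α-1) / ψ (1/(N s)) *
        ∑ i ∈ Finset.range (N s), c (jj r) (x s i) (x s (i+1)) := by
      simp only [c]
      rw [Finset.sum_comm, Finset.mul_sum]
      refine Finset.sum_le_sum fun k _ => ?_
      exact hchain (N s) hN2 (fun i => (y (jj r) (x s i) k : ℝ)) (fun i => (y (jj r) (x s i) k).2)
    have h2 : ∑ i ∈ Finset.range (N s), c (jj r) (x s i) (x s (i+1)) ≤ N s * (2^s * fr s) := by
      calc _ ≤ ∑ i ∈ Finset.range (N s), (2^s * fr s) :=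
            Finset.sum_le_sum fun i hi => hgood r i (Finset.mem_range.1 hi)
        _ = _ := by simp
    have h3 : B * (N s:ℝ)^(α-1) / ψ (1/(N s)) * (N s * (2^s * fr s)) =
        B * 2^s * (fr s * (N s:ℝ)^α / ψ (1/(N s))) := by
      have : (N s:ℝ)^α = (N s:ℝ)^(α-1) * N s := by
        conv_lhs => rw [show α = (α - 1) + 1 by ring]
        rw [Real.rpow_add hNpos, Real.rpow_one]
      rw [this]; ring
    have h4 := hratio s
    calc _ ≤ _ := h1
      _ ≤ B * (N s:ℝ)^(α-1) / ψ (1/(N s)) * (N s * (2^s * fr s)) :=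
          mul_le_mul_of_nonneg_left h2 (by positivity)
      _ = B * 2^s * (fr s * (N s:ℝ)^α / ψ (1/(N s))) := h3
      _ ≤ B * 2^s * (A * (1/4)^s) := by
          refine mul_le_mul_of_nonneg_left ?_ (by positivity)
          rw [hNc]; exact h4
      _ = B * A * (1/2)^s := by
          rw [show (1/4:ℝ) = 1/2 * (1/2) by norm_num, mul_pow]
          have : (2:ℝ)^s * (1/2)^s = 1 := by rw [← mul_pow]; norm_num
          linear_combination (B * A * (1/2)^s) * this
      _ ≤ B * A * (1/2)^r := by
          refine mul_le_mul_of_nonneg_left ?_ (by positivity)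
          exact pow_le_pow_of_le_one (by norm_num) (by norm_num) (by omega)
  have s2 : Summable fun j => c j (v j) (v' j) := by
    rw [← hjinj.summable_iff]
    · refine Summable.of_nonneg_of_le (fun r => hcn _ _ _) hbound (summable_geometric_two.mul_left _)
    · intro j hj
      simp only [v, v', hj, if_false]; exact hc0 _ _
  have s1 := (main v v' hv hv').2 s2
  have s3 := s1.comp_injective hjinj
  have e : (fun j => f |(ecode (v j):ℝ) - ecode (v' j)|) ∘ jj = fun _ => f 1 := by
    ext r
    simp only [Function.comp, v, v', mem_range_self, if_true]
    rw [hex _ _ (Nat.zero_le _), hex _ _ le_rfl]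
    simp [N]
  rw [e, summable_const_iff] at s3
  exact hf1.ne' s3


theorem u_pos (w δs : ℕ → ℝ) (k : ℕ → ℕ) (J : Set ℕ) (h0 : w 0 = 1)
    (hj : ∀ n m, n + 1 = k m → m ∈ J → w (n+1) = δs m * w n)
    (hnj : ∀ n, (¬ ∃ m ∈ J, n + 1 = k m) → w (n+1) = w n) (hδ : ∀ m, δs m ∈ Ioo (0:ℝ) 1) (n : ℕ) :
    0 < w n := by
  induction n with
  | zero => rw [h0]; norm_num
  | succ n ih =>
    by_cases h : ∃ m ∈ J, n + 1 = k m
    · obtain ⟨m, hm, e⟩ := h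
      rw [hj n m e hm]; exact mul_pos (hδ m).1 ih
    · rw [hnj n h]; exact ih

theorem u_anti (w δs : ℕ → ℝ) (k : ℕ → ℕ) (J : Set ℕ) (h0 : w 0 = 1)
    (hj : ∀ n m, n + 1 = k m → m ∈ J → w (n+1) = δs m * w n)
    (hnj : ∀ n, (¬ ∃ m ∈ J, n + 1 = k m) → w (n+1) = w n) (hδ : ∀ m, δs m ∈ Ioo (0:ℝ) 1) :
    Antitone w := by
  refine antitone_nat_of_succ_le fun n => ?_
  have hp := u_pos w δs k J h0 hj hnj hδ n
  by_cases h : ∃ m ∈ J, n + 1 = k m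
  · obtain ⟨m, hm, e⟩ := h
    rw [hj n m e hm]
    exact mul_le_of_le_one_left hp.le (hδ m).2.le
  · rw [hnj n h]

theorem u_lower (w δs : ℕ → ℝ) (k : ℕ → ℕ) (J : Set ℕ) (h0 : w 0 = 1)
    (hj : ∀ n m, n + 1 = k m → m ∈ J → w (n+1) = δs m * w n)
    (hnj : ∀ n, (¬ ∃ m ∈ J, n + 1 = k m) → w (n+1) = w n) (hδ : ∀ m, δs m ∈ Ioo (0:ℝ) 1)
    (hk : StrictMono k) (δ0 : ℝ) (hδ0 : 0 < δ0) (hδle : ∀ m, δ0 ≤ δs m)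
    (n m0 : ℕ) (hm0 : ∀ m, n < k m → m0 ≤ m) :
    ∀ n', n ≤ n' → ∀ i, n' < k (m0 + i) → δ0^i * w n ≤ w n' := by
  have hp := u_pos w δs k J h0 hj hnj hδ
  have hδ1 : δ0 ≤ 1 := (hδle 0).trans (hδ 0).2.le
  intro n' hn'
  induction n', hn' using Nat.le_induction with
  | base =>
    intro i _
    exact mul_le_of_le_one_left (hp n).le (pow_le_one₀ hδ0.le hδ1)
  | succ n' hn' ih =>
    intro i hi
    by_cases h : ∃ m ∈ J, n' + 1 = k m
    · obtain ⟨m, hm, e⟩ := h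
      have h1 : m < m0 + i := hk.lt_iff_lt.1 (by omega)
      have h2 : m0 ≤ m := hm0 m (by omega)
      obtain ⟨i', rfl⟩ : ∃ i', i = i' + 1 := ⟨i - 1, by omega⟩
      have h3 : k m ≤ k (m0 + i') := hk.monotone (by omega)
      have := ih i' (by omega)
      rw [hj n' m e hm, pow_succ]
      calc δ0^i' * δ0 * w n = δ0 * (δ0^i' * w n) := by ring
        _ ≤ δ0 * w n' := mul_le_mul_of_nonneg_left this hδ0.le
        _ ≤ δs m * w n' := mul_le_mul_of_nonneg_right (hδle m) (hp n').le
    · rw [hnj n' h]; exact ih i (by omega)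

theorem u_const (w : ℕ → ℝ) (k : ℕ → ℕ) (J : Set ℕ)
    (hnj : ∀ n, (¬ ∃ m ∈ J, n + 1 = k m) → w (n+1) = w n) (n : ℕ) :
    ∀ n', n ≤ n' → (∀ m ∈ J, n < k m → k m ≤ n' → False) → w n' = w n := by
  intro n' hn'
  induction n', hn' using Nat.le_induction with
  | base => intro _; rfl
  | succ n' hn' ih =>
    intro h
    rw [hnj n', ih fun m hm h1 h2 => h m hm h1 (by omega)]
    rintro ⟨m, hm, e⟩
    exact h m hm (by omega) (by omega)

theorem u_upper (w δs : ℕ → ℝ) (k : ℕ → ℕ) (J : Set ℕ) (h0 : w 0 = 1)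
    (hj : ∀ n m, n + 1 = k m → m ∈ J → w (n+1) = δs m * w n)
    (hnj : ∀ n, (¬ ∃ m ∈ J, n + 1 = k m) → w (n+1) = w n) (hδ : ∀ m, δs m ∈ Ioo (0:ℝ) 1)
    (hk : StrictMono k) (hk0 : 2 ≤ k 0) (δ1 : ℝ) (hδ1 : 0 < δ1) (hδle : ∀ m, δs m ≤ δ1)
    (b : ℕ) : ∀ i, (∀ m, b ≤ m → m < b + i → m ∈ J) → w (k (b+i) - 1) ≤ δ1^i := by
  have hp := u_pos w δs k J h0 hj hnj hδ
  have ha := u_anti w δs k J h0 hj hnj hδ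
  intro i
  induction i with
  | zero => intro _; rw [pow_zero, ← h0]; exact ha (Nat.zero_le _)
  | succ i ih =>
    intro h
    have h1 := ih fun m hm hm' => h m hm (by omega)
    have h2 : 2 ≤ k (b+i) := hk0.trans (hk.monotone (Nat.zero_le _))
    have h3 : k (b+i) < k (b+(i+1)) := hk (by omega)
    have h4 : w (k (b+i) - 1 + 1) = δs (b+i) * w (k (b+i) - 1) :=
      hj _ _ (by omega) (h _ (by omega) (by omega))
    calc w (k (b+(i+1)) - 1) ≤ w (k (b+i) - 1 + 1) := ha (by omega)
      _ = δs (b+i) * w (k (b+i) - 1) := h4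
      _ ≤ δ1 * δ1^i := mul_le_mul (hδle _) h1 (hp _).le hδ1.le
      _ = δ1^(i+1) := by ring

theorem half (α : ℝ) (hα : 1 ≤ α)
    (a : ℕ → ℕ) (ha0 : a 0 = 0) (haS : ∀ l, a (l+1) = a l + 1 + l * a l)
    (δs : ℕ → ℝ) (hδmem : ∀ m, δs m ∈ Ioo (0:ℝ) 1)
    (hinf : 0 < ⨅ m, δs m) (hsup : (⨆ m, δs m) < 1)
    (k : ℕ → ℕ) (hkmono : StrictMono k) (hk0 : 2 ≤ k 0)
    (hk2 : ∀ m, 2 * k m ≤ k (m+1))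
    (u : Set ℕ → ℕ → ℝ) (hu0 : ∀ U, u U 0 = 1)
    (huk : ∀ (U : Set ℕ) (n m l : ℕ), n + 1 = k m → a l ≤ m → m < a (l+1) → l ∈ U →
      u U (n+1) = δs m * u U n)
    (hunk : ∀ (U : Set ℕ) (n : ℕ),
      (¬ ∃ m l, n + 1 = k m ∧ a l ≤ m ∧ m < a (l+1) ∧ l ∈ U) → u U (n+1) = u U n)
    (φ : ℝ → ℝ) (hφc : ContinuousOn φ (Icc 0 1)) (hφei : EssIncOn φ (Icc 0 1))
    (hφnn : ∀ t ∈ Icc (0:ℝ) 1, 0 ≤ φ t) (hφpos : ∀ t ∈ Ioc (0:ℝ) 1, 0 < φ t)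
    (hlam : ∃ lam > (0:ℝ), ∀ t ∈ Icc (0:ℝ) 1, lam * φ t ≤ φ (t^2))
    (φU : Set ℕ → ℝ → ℝ)
    (hφUc : ∀ U, ContinuousOn (φU U) (Icc 0 1))
    (hφUm : ∀ U, MonotoneOn (φU U) (Icc 0 1))
    (hφUnn : ∀ U, ∀ t ∈ Icc (0:ℝ) 1, 0 ≤ φU U t)
    (hφUval : ∀ U (n : ℕ), φU U ((1/2:ℝ)^n) = u U n)
    (U V : Set ℕ) (hUV : (U \ V).Infinite) :
    ¬ BorelReducible (EF (fun t => t ^ α * φ t * φU U t))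
        (EF (fun t => t ^ α * φ t * φU V t)) := by
  intro hred
  obtain ⟨C, hC, hφC⟩ := hφei
  obtain ⟨lam, hlam, hφsq⟩ := hlam
  let J : Set ℕ → Set ℕ := fun U => {m | ∃ l, a l ≤ m ∧ m < a (l+1) ∧ l ∈ U}
  have hj : ∀ (U : Set ℕ) (n m : ℕ), n + 1 = k m → m ∈ J U → u U (n+1) = δs m * u U n := by
    rintro U n m e ⟨l, h1, h2, h3⟩
    exact huk U n m l e h1 h2 h3
  have hnj : ∀ (U : Set ℕ) (n : ℕ), (¬ ∃ m ∈ J U, n + 1 = k m) → u U (n+1) = u U n := by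
    intro U n h
    apply hunk
    rintro ⟨m, l, e, h1, h2, h3⟩
    exact h ⟨m, ⟨l, h1, h2, h3⟩, e⟩
  set δ0 := ⨅ m, δs m with hδ0
  set δ1 := ⨆ m, δs m with hδ1
  have h_delta_lo : ∀ m, δ0 ≤ δs m := fun m => ciInf_le ⟨0, by rintro _ ⟨m, rfl⟩; exact (hδmem m).1.le⟩ m
  have h_delta_hi : ∀ m, δs m ≤ δ1 := fun m => le_ciSup (f := δs) ⟨1, by rintro _ ⟨m, rfl⟩; exact (hδmem m).2.le⟩ m
  have h_delta_pos : 0 < δ1 := (hδmem 0).1.trans_le (h_delta_hi 0)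
  have hup := fun U => u_pos (u U) δs k (J U) (hu0 U) (hj U) (hnj U) hδmem
  have hua := fun U => u_anti (u U) δs k (J U) (hu0 U) (hj U) (hnj U) hδmem
  have hamono : StrictMono a := strictMono_nat_of_lt_succ fun l => by rw [haS]; omega
  -- the ratio
  have hratio : ∀ r : ℕ, ∃ n, 1 ≤ n ∧ r ≤ n ∧ u U n ≤ (1/4)^r * u V n := by
    intro r
    obtain ⟨q, hq⟩ := exists_pow_lt_of_lt_one hinf hsup
    obtain ⟨p, hp⟩ := exists_pow_lt_of_lt_one (by positivity : (0:ℝ) < (1/4)^r) hsup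
    obtain ⟨l, hl, hlgt⟩ := hUV.exists_gt (q + p + r + 1)
    have hal : l ≤ a l := hamono.le_apply
    have hkk : ∀ m, m + 2 ≤ k m := by
      intro m
      induction m with
      | zero => simpa using hk0
      | succ m ih => have := hkmono (Nat.lt_succ_self m); simp only [Nat.succ_eq_add_one] at this; omega
    refine ⟨k (a (l+1)) - 1, ?_, ?_, ?_⟩
    · have := hkk (a (l+1)); omega
    · have := hkk (a (l+1)); have := hamono (Nat.lt_succ_self l)
      simp only [Nat.succ_eq_add_one] at this; omega
    · have e : a (l+1) = a l + (1 + l * a l) := by rw [haS]; ring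
      have b1 : u U (k (a (l+1)) - 1) ≤ δ1^(1 + l * a l) := by
        have := u_upper (u U) δs k (J U) (hu0 U) (hj U) (hnj U) hδmem hkmono hk0 δ1 h_delta_pos h_delta_hi (a l)
          (1 + l * a l) (fun m h1 h2 => ⟨l, h1, by omega, hl.1⟩)
        rwa [← e] at this
      have b2 : δ0^(a l) ≤ u V (k (a l) - 1) := by
        have := u_lower (u V) δs k (J V) (hu0 V) (hj V) (hnj V) hδmem hkmono δ0 hinf h_delta_lo 0 0
          (fun m _ => Nat.zero_le m) (k (a l) - 1) (Nat.zero_le _) (a l)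
          (by have := hkk (a l); rw [zero_add]; omega)
        rwa [hu0, mul_one] at this
      have b3 : u V (k (a (l+1)) - 1) = u V (k (a l) - 1) := by
        apply u_const (u V) k (J V) (hnj V)
        · have := hkmono.monotone (hamono (Nat.lt_succ_self l)).le
          simp only [Nat.succ_eq_add_one] at this; omega
        · rintro m ⟨l', h1, h2, h3⟩ h4 h5
          have h6 : a l ≤ m := by
            by_contra hlt
            have := hkmono (not_le.1 hlt)
            omega
          have h7 : m < a (l+1) := by
            by_contra hge
            have := hkmono.monotone (not_lt.1 hge)
            have := hkk (a (l+1))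
            omega
          have h8 : l < l' + 1 := hamono.lt_iff_lt.1 (by omega)
          have h9 : l' < l + 1 := hamono.lt_iff_lt.1 (by omega)
          have : l = l' := by omega
          subst this
          exact hl.2 h3
      rw [b3]
      refine b1.trans (le_trans ?_ (mul_le_mul_of_nonneg_left b2 (by positivity)))
      have c1 : (δ1^q)^(a l) ≤ δ0^(a l) := pow_le_pow_left₀ (by positivity) hq.le _
      have c2 : δ1^(1 + l * a l) ≤ δ1^p * (δ1^q)^(a l) := by
        rw [← pow_mul, ← pow_add]
        apply pow_le_pow_of_le_one h_delta_pos.le hsup.le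
        obtain ⟨t, rfl⟩ : ∃ t, l = q + p + t := ⟨l - (q+p), by omega⟩
        have ht : 1 ≤ a (q+p+t) := by omega
        nlinarith [Nat.zero_le (t * a (q+p+t)), Nat.mul_le_mul_left p ht]
      exact c2.trans (mul_le_mul hp.le c1 (by positivity) (by positivity))
  choose n hn1 hnr hnratio using hratio
  -- φU properties
  have hφUpos : ∀ W, ∀ t ∈ Ioc (0:ℝ) 1, 0 < φU W t := by
    intro W t ht
    obtain ⟨i, hi⟩ := exists_pow_lt_of_lt_one ht.1 (by norm_num : (1/2:ℝ) < 1)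
    have h1 : (1/2:ℝ)^i ∈ Icc (0:ℝ) 1 := ⟨by positivity, pow_le_one₀ (by norm_num) (by norm_num)⟩
    have := hφUm W h1 ⟨ht.1.le, ht.2⟩ hi.le
    rw [hφUval] at this
    exact (hup W i).trans_le this
  have husq : ∀ W i, δ0^2 * u W i ≤ u W (2*i+2) := by
    intro W i
    have hex : ∃ m, i < k m := ⟨i, by
      have : i ≤ k i := hkmono.le_apply
      rcases this.lt_or_eq with h | h
      · exact h
      · have h1 : ∀ m, m + 2 ≤ k m := by
          intro m
          induction m with
          | zero => simpa using hk0
          | succ m ih => have := hkmono (Nat.lt_succ_self m); simp only [Nat.succ_eq_add_one] at this; omega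
        have := h1 i; omega⟩
    classical
    have hs := Nat.find_spec hex
    refine u_lower (u W) δs k (J W) (hu0 W) (hj W) (hnj W) hδmem hkmono δ0 hinf h_delta_lo i (Nat.find hex)
      (fun m hm => Nat.find_min' hex hm) (2*i+2) (by omega) 2 ?_
    have h1 := hk2 (Nat.find hex)
    have h2 := hk2 (Nat.find hex + 1)
    rw [add_assoc] at h2
    norm_num at h2
    omega
  have hφUsq : ∀ W, ∀ t ∈ Icc (0:ℝ) 1, δ0^2 * φU W t ≤ φU W (t^2) := by
    intro W t ht
    have hδ01 : δ0^2 ≤ 1 := pow_le_one₀ hinf.le ((h_delta_lo 0).trans (hδmem 0).2.le)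
    rcases ht.1.eq_or_lt with h | h
    · rw [← h]
      norm_num
      exact mul_le_of_le_one_left (hφUnn W 0 (by norm_num)) hδ01
    · obtain ⟨i, hi1, hi2⟩ := exists_nat_pow_near_of_lt_one h ht.2 (by norm_num : (0:ℝ) < 1/2) (by norm_num)
      have hpow : ∀ i : ℕ, (1/2:ℝ)^i ∈ Icc (0:ℝ) 1 := fun i =>
        ⟨by positivity, pow_le_one₀ (by norm_num) (by norm_num)⟩
      have h1 := hφUm W ht (hpow i) hi2
      have hsqI : t^2 ∈ Icc (0:ℝ) 1 := ⟨by positivity, pow_le_one₀ ht.1 ht.2⟩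
      have h2 : (1/2:ℝ)^(2*i+2) ≤ t^2 := by
        have : (1/2:ℝ)^(2*i+2) = ((1/2)^(i+1))^2 := by rw [← pow_mul]; congr 1; ring
        rw [this]
        exact pow_le_pow_left₀ (by positivity) hi1.le 2
      have h3 := hφUm W (hpow _) hsqI h2
      rw [hφUval] at h1 h3
      calc _ ≤ δ0^2 * u W i := mul_le_mul_of_nonneg_left h1 (by positivity)
        _ ≤ _ := husq W i
        _ ≤ _ := h3
  have e2n : ∀ i : ℕ, (1/2^i : ℝ) = (1/2)^i := fun i => by rw [div_pow, one_pow]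
  have hpowI : ∀ i : ℕ, (1/2:ℝ)^i ∈ Ioc (0:ℝ) 1 := fun i =>
        ⟨by positivity, pow_le_one₀ (by norm_num) (by norm_num)⟩
  have hφ1 : 0 < φ 1 := hφpos 1 (by norm_num)
  have hsq1 : ∀ t ∈ Icc (0:ℝ) 1, t^2 ∈ Icc (0:ℝ) 1 := fun t ht =>
    ⟨by have := ht.1; positivity, pow_le_one₀ ht.1 ht.2⟩
  refine core α hα (fun t => t ^ α * φ t * φU U t) (fun t => φ t * φU V t) C (lam * δ0^2)
    (1 + C * φ 1) hC (by positivity) ?_ ?_ ?_ ?_ ?_ ?_ ?_ n hn1 ?_ (by positivity) ?_ ?_ ?_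
  · intro x hx y hy hxy
    have h1 := hφC x hx y hy hxy
    have h2 := hφUm V hx hy hxy
    calc φ x * φU V x ≤ (C * φ y) * φU V y :=
          mul_le_mul h1 h2 (hφUnn V x hx) (mul_nonneg (by linarith) (hφnn y hy))
      _ = _ := by ring
  · exact fun t ht => mul_nonneg (hφnn t ht) (hφUnn V t ht)
  · exact fun t ht => mul_pos (hφpos t ht) (hφUpos V t ht)
  · intro t ht
    calc lam * δ0^2 * (φ t * φU V t) = (lam * φ t) * (δ0^2 * φU V t) := by ring
      _ ≤ φ (t^2) * φU V (t^2) := mul_le_mul (hφsq t ht) (hφUsq V t ht)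
          (mul_nonneg (by positivity) (hφUnn V t ht)) (hφnn _ (hsq1 t ht))
  · exact hφc.mul (hφUc V)
  · simp [Real.zero_rpow (by linarith : α ≠ 0)]
  · have : φU U 1 = 1 := by have := hφUval U 0; rwa [pow_zero, hu0] at this
    simp [this, hφ1]
  · intro r
    rw [e2n]
    exact mul_pos (mul_pos (Real.rpow_pos_of_pos (by positivity) _) (hφpos _ (hpowI _)))
      (hφUpos U _ (hpowI _))
  · intro r
    rw [e2n, hφUval]
    have hI := hpowI (n r)
    have h1 : ((1/2:ℝ)^(n r))^α ≤ (1/2)^r := by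
      calc ((1/2:ℝ)^(n r))^α ≤ ((1/2:ℝ)^(n r))^(1:ℝ) :=
            Real.rpow_le_rpow_of_exponent_ge hI.1 hI.2 hα
        _ = (1/2:ℝ)^(n r) := Real.rpow_one _
        _ ≤ (1/2)^r := pow_le_pow_of_le_one (by norm_num) (by norm_num) (hnr r)
    have h2 : φ ((1/2:ℝ)^(n r)) ≤ C * φ 1 := hφC _ ⟨hI.1.le, hI.2⟩ 1 (by norm_num) hI.2
    have h3 : u U (n r) ≤ 1 := by rw [← hu0 U]; exact hua U (Nat.zero_le _)
    have h0 := (hφpos _ hI).le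
    calc _ ≤ (1/2)^r * (C * φ 1) * 1 := by
          refine mul_le_mul (mul_le_mul h1 h2 h0 (by positivity)) h3 (hup U _).le (by positivity)
      _ ≤ _ := by
          have : (0:ℝ) ≤ (1/2)^r := by positivity
          linarith
  · intro r
    rw [e2n, hφUval, hφUval]
    have hI := hpowI (n r)
    have hpφ := hφpos _ hI
    have hpu := hup V (n r)
    have e : ((1/2:ℝ)^(n r))^α * ((2:ℝ)^(n r))^α = 1 := by
      rw [← Real.mul_rpow (by positivity) (by positivity), ← mul_pow]; norm_num
    have e3 : ((1/2:ℝ)^(n r))^α * φ ((1/2)^(n r)) * u U (n r) * ((2:ℝ)^(n r))^α / (φ ((1/2)^(n r)) * u V (n r))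
        = u U (n r) / u V (n r) := by
      rw [div_eq_div_iff (by positivity) (by positivity)]
      linear_combination (φ ((1/2)^(n r)) * u U (n r) * u V (n r)) * e
    rw [e3]
    calc _ ≤ (1/4:ℝ)^r := by rw [div_le_iff₀ hpu]; exact hnratio r
      _ ≤ _ := by
        have : (0:ℝ) ≤ (1/4)^r := by positivity
        have h2 : 0 ≤ C * φ 1 := by positivity
        nlinarith [mul_nonneg h2 this]
  · have e : (fun t => t ^ α * (φ t * φU V t)) = fun t => t ^ α * φ t * φU V t := by
      ext t; ring
    rw [e]; exact hred



theorem stmt14 (α : ℝ) (hα : 1 ≤ α)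
    (a : ℕ → ℕ) (ha0 : a 0 = 0) (haS : ∀ l, a (l+1) = a l + 1 + l * a l)
    (δs : ℕ → ℝ) (hδmem : ∀ m, δs m ∈ Ioo (0:ℝ) 1)
    (hinf : 0 < ⨅ m, δs m) (hsup : (⨆ m, δs m) < 1)
    (k : ℕ → ℕ) (hkmono : StrictMono k) (hk0 : 2 ≤ k 0)
    (hk2 : ∀ m, 2 * k m ≤ k (m+1))
    (u : Set ℕ → ℕ → ℝ) (hu0 : ∀ U, u U 0 = 1)
    (huk : ∀ (U : Set ℕ) (n m l : ℕ), n + 1 = k m → a l ≤ m → m < a (l+1) → l ∈ U →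
      u U (n+1) = δs m * u U n)
    (hunk : ∀ (U : Set ℕ) (n : ℕ),
      (¬ ∃ m l, n + 1 = k m ∧ a l ≤ m ∧ m < a (l+1) ∧ l ∈ U) → u U (n+1) = u U n)
    (φ : ℝ → ℝ) (hφc : ContinuousOn φ (Icc 0 1)) (hφei : EssIncOn φ (Icc 0 1))
    (hφnn : ∀ t ∈ Icc (0:ℝ) 1, 0 ≤ φ t) (hφpos : ∀ t ∈ Ioc (0:ℝ) 1, 0 < φ t)
    (hlam : ∃ lam > (0:ℝ), ∀ t ∈ Icc (0:ℝ) 1, lam * φ t ≤ φ (t^2))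
    (φU : Set ℕ → ℝ → ℝ)
    (hφUc : ∀ U, ContinuousOn (φU U) (Icc 0 1))
    (hφUm : ∀ U, MonotoneOn (φU U) (Icc 0 1))
    (hφUnn : ∀ U, ∀ t ∈ Icc (0:ℝ) 1, 0 ≤ φU U t)
    (hφUval : ∀ U (n : ℕ), φU U ((1/2:ℝ)^n) = u U n)
    (U V : Set ℕ) (hUV : (U \ V).Infinite) (hVU : (V \ U).Infinite) :
    ¬ BorelReducible (EF (fun t => t ^ α * φ t * φU U t))
        (EF (fun t => t ^ α * φ t * φU V t)) ∧
    ¬ BorelReducible (EF (fun t => t ^ α * φ t * φU V t))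
        (EF (fun t => t ^ α * φ t * φU U t)) := by
  exact ⟨half α hα a ha0 haS δs hδmem hinf hsup k hkmono hk0 hk2 u hu0 huk hunk φ hφc hφei hφnn hφpos
      hlam φU hφUc hφUm hφUnn hφUval U V hUV,
    half α hα a ha0 haS δs hδmem hinf hsup k hkmono hk0 hk2 u hu0 huk hunk φ hφc hφei hφnn hφpos
      hlam φU hφUc hφUm hφUnn hφUval V U hVU⟩
end

section
/- Let α ≥ 1. Fix the data: a_0 = 0, a_{l+1} = a_l + 1 + l·a_l and I_l = [a_l, a_{l+1}) ∩ ω; a sequence (δ_m)_{m<ω} in (0,1) with 0 < inf_m δ_m ≤ sup_m δ_m < 1; a strictly increasing sequence (k_m)_{m<ω} of natural numbers with k_0 ≥ 2 and k_{m+1} ≥ 2·k_m. For U ⊆ ω define u_U(0) = 1 and, for n > 0, u_U(n) = δ_m·u_U(n−1) if n = k_m for some m ∈ I_l with l ∈ U, and u_U(n) = u_U(n−1) otherwise. Let φ_U : [0,1] → [0,∞) be a continuous increasing function with φ_U(1/2^n) = u_U(n) for every n < ω, and set f_U(x) = x^α·φ_U(x) for x ∈ [0,1]. Then for every β with α < β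 < ∞: ℝ^ω/ℓ_α ≤_B E_{f_U} and E_{f_U} ≤_B ℝ^ω/ℓ_β. -/
open Set

theorem red_trans {X Y Z : Type*} [MeasurableSpace X] [MeasurableSpace Y] [MeasurableSpace Z]
    {E : X → X → Prop} {F : Y → Y → Prop} {G : Z → Z → Prop}
    (h1 : BorelReducible E F) (h2 : BorelReducible F G) : BorelReducible E G := by
  obtain ⟨a, ha, ha'⟩ := h1
  obtain ⟨b, hb, hb'⟩ := h2
  exact ⟨b ∘ a, hb.comp ha, fun x y => (ha' x y).trans (hb' _ _)⟩

/-- slow variation -/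
theorem slow (u : ℕ → ℝ) (D : ℝ) (hD : 1 ≤ D) (k : ℕ → ℕ) (hkmono : StrictMono k)
    (hk2 : ∀ m, 2 * k m ≤ k (m+1)) (hpos : ∀ n, 0 < u n)
    (hstep : ∀ n, u n ≤ D * u (n+1))
    (hconst : ∀ n, (¬ ∃ m, n + 1 = k m) → u (n+1) = u n) (Q : ℝ) (hQ0 : 0 < Q) (hQ1 : Q < 1) :
    ∃ K : ℝ, 1 ≤ K ∧ ∀ i d, u i * Q ^ d ≤ K * u (i + d) := by
  have key : ∀ i d, ∃ J : ℕ, u i ≤ D ^ J * u (i + d) ∧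
      (J = 0 ∨ ∃ m, k m ≤ i + d ∧ i + 2 ^ (J-1) ≤ k m) := by
    intro i d
    induction d with
    | zero => exact ⟨0, by simp, Or.inl rfl⟩
    | succ d ih =>
      obtain ⟨J, hJ, hJ'⟩ := ih
      by_cases h : ∃ m, i + d + 1 = k m
      · obtain ⟨m', hm'⟩ := h
        refine ⟨J + 1, ?_, Or.inr ⟨m', by omega, ?_⟩⟩
        · calc u i ≤ D ^ J * u (i + d) := hJ
            _ ≤ D ^ J * (D * u (i + d + 1)) := by
              have := hstep (i + d)
              gcongr
            _ = D ^ (J+1) * u (i + (d + 1)) := by rw [pow_succ, mul_assoc]; rfl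
        · rcases hJ' with rfl | ⟨m, hm1, hm2⟩
          · simp; omega
          · have hlt : m < m' := hkmono.lt_iff_lt.1 (by omega)
            have h3 : k (m+1) ≤ k m' := hkmono.monotone hlt
            have h4 := hk2 m
            rcases J with _ | J
            · simp; omega
            · simp only [Nat.add_sub_cancel] at hm2 ⊢
              rw [pow_succ]
              omega
      · refine ⟨J, ?_, ?_⟩
        · rw [← add_assoc, hconst _ h]; exact hJ
        · rcases hJ' with rfl | ⟨m, hm1, hm2⟩
          · exact Or.inl rfl
          · exact Or.inr ⟨m, by omega, hm2⟩
  obtain ⟨a, ha⟩ := pow_unbounded_of_one_lt D ((one_lt_inv₀ hQ0).2 hQ1)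
  have hDa : D * Q ^ a ≤ 1 := by
    rw [inv_pow] at ha
    have hp : 0 < Q ^ a := by positivity
    calc D * Q ^ a ≤ (Q^a)⁻¹ * Q ^ a := by gcongr
      _ = 1 := by field_simp
  have hJ2 : ∀ J : ℕ, J ^ 2 ≤ 2 * 2 ^ J := by
    intro J
    rcases lt_or_ge J 3 with h | h
    · interval_cases J <;> norm_num
    · induction J, h using Nat.le_induction with
      | base => norm_num
      | succ J hJ ih => rw [pow_succ 2 J]; nlinarith
  have hQi : 1 ≤ Q⁻¹ := ((one_lt_inv₀ hQ0).2 hQ1).le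
  refine ⟨Q⁻¹ ^ (2 * a ^ 2 + 1), one_le_pow₀ hQi, ?_⟩
  intro i d
  obtain ⟨J, hJ, hJ'⟩ := key i d
  have h2J : 2 ^ J ≤ 1 + 2 * d := by
    rcases hJ' with rfl | ⟨m, hm1, hm2⟩
    · simp
    · rcases J with _ | J
      · simp
      · simp only [Nat.add_sub_cancel] at hm2
        rw [pow_succ]; omega
  have haJ : a * J ≤ 2 * a ^ 2 + 1 + d := by
    have h1 := hJ2 J
    zify at h1 h2J ⊢
    nlinarith [sq_nonneg (4 * (a:ℤ) - J)]
  have hu := hpos (i + d)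
  have e1 : D ^ J * Q ^ (a * J) ≤ 1 := by
    rw [pow_mul, ← mul_pow]
    exact pow_le_one₀ (by positivity) hDa
  have e2 : Q ^ (2 * a ^ 2 + 1 + d) ≤ Q ^ (a * J) :=
    pow_le_pow_of_le_one hQ0.le hQ1.le haJ
  have e3 : D ^ J * Q ^ (2 * a ^ 2 + 1 + d) ≤ 1 :=
    le_trans (by gcongr) e1
  have e4 : D ^ J * Q ^ d ≤ Q⁻¹ ^ (2 * a ^ 2 + 1) := by
    rw [inv_pow, ← one_div, le_div_iff₀ (by positivity), mul_assoc, ← pow_add, add_comm d]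
    exact e3
  calc u i * Q ^ d ≤ (D ^ J * u (i+d)) * Q ^ d := by gcongr
    _ = (D ^ J * Q ^ d) * u (i + d) := by ring
    _ ≤ _ := by gcongr

noncomputable def trig (s : Bool) (x : ℝ) : ℝ := if s then Real.sin x else Real.cos x

theorem trig_le_two (s : Bool) (a b : ℝ) : |trig s a - trig s b| ≤ 2 := by
  unfold trig
  rw [abs_le]
  split_ifs
  · constructor <;> linarith [Real.neg_one_le_sin a, Real.sin_le_one a, Real.neg_one_le_sin b, Real.sin_le_one b]
  · constructor <;> linarith [Real.neg_one_le_cos a, Real.cos_le_one a, Real.neg_one_le_cos b, Real.cos_le_one b]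

theorem trig_meas (s : Bool) : Measurable (trig s) := by
  unfold trig
  cases s <;> simp <;> fun_prop

theorem trig_lip (s : Bool) (a b : ℝ) : |trig s a - trig s b| ≤ |a - b| := by
  have h0 : ∀ z : ℝ, |Real.sin z| ≤ |z| := fun z => Real.abs_sin_le_abs
  unfold trig
  split_ifs
  · rw [Real.sin_sub_sin, abs_mul, abs_mul]
    have h1 := h0 ((a-b)/2)
    have h2 := Real.abs_cos_le_one ((a+b)/2)
    rw [abs_div, abs_two] at h1
    rw [abs_two]
    nlinarith [abs_nonneg (Real.sin ((a-b)/2)), abs_nonneg (Real.cos ((a+b)/2))]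
  · rw [Real.cos_sub_cos, abs_mul, abs_mul]
    have h1 := h0 ((a-b)/2)
    have h2 := Real.abs_sin_le_one ((a+b)/2)
    rw [abs_div, abs_two] at h1
    rw [abs_neg, abs_two]
    nlinarith [abs_nonneg (Real.sin ((a-b)/2)), abs_nonneg (Real.sin ((a+b)/2))]

theorem trig_low (a b : ℝ) (h1 : 1/2 ≤ |a - b|) (h2 : |a - b| ≤ 1) :
    ∃ s, 1/6 ≤ |trig s a - trig s b| := by
  have hc : Real.cos (a - b) ≤ 1 - 1/32 := by
    rw [← Real.cos_abs]
    have e : |a - b| = 2 * (|a-b|/2) := by ring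
    rw [e, Real.cos_two_mul, Real.cos_sq']
    have := Real.mul_le_sin (x := |a-b|/2) (by positivity) (by linarith [Real.pi_gt_three])
    have hpi : 1/2 ≤ 2 / Real.pi := by
      rw [div_le_div_iff₀ (by norm_num) Real.pi_pos]; linarith [Real.pi_le_four]
    have h3 : 1/2 * (1/4) ≤ Real.sin (|a-b|/2) := by
      refine le_trans ?_ this
      have : 1/4 ≤ |a-b|/2 := by linarith
      gcongr
    nlinarith
  by_contra hcon
  push Not at hcon
  have hs := hcon true
  have hk := hcon false
  simp only [trig, if_true, Bool.false_eq_true, if_false] at hs hk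
  rw [Real.cos_sub] at hc
  rw [abs_lt] at hs hk
  nlinarith [Real.sin_sq_add_cos_sq a, Real.sin_sq_add_cos_sq b]

theorem natAbs_aux1 (i d : ℕ) : ((i : ℤ) - ((i + d : ℕ) : ℤ)).natAbs = d := by omega

theorem natAbs_aux2 (n d : ℕ) : (((n + d : ℕ) : ℤ) - (n : ℤ)).natAbs = d := by omega

theorem inj_aux (n : ℕ) :
    Function.Injective (fun p : ℕ × Bool => (((p.1 : ℤ) - n, p.2) : ℤ × Bool)) := by
    rintro ⟨i, s⟩ ⟨j, s'⟩ h
    simp only [Prod.mk.injEq] at h ⊢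
    exact ⟨by omega, h.2⟩

theorem bound_low (α β : ℝ) (u : ℕ → ℝ) (Q R K : ℝ) (hQ0 : 0 < Q) (hQR' : Q ≤ R) (hK0 : 0 ≤ K)
    (hQ : Q ^ (2:ℝ) = (1/2:ℝ) ^ (β - α)) (i d : ℕ) (hpos : ∀ n, 0 < u n)
    (hK : u i * Q ^ d ≤ K * u (i + d)) (s : Bool) (x y : ℝ) (ht : |x - y| ≤ (1/2:ℝ)^(i+d))
    (hβ : 0 < β) :
    ((1/2:ℝ)^i) ^ α * u i * |trig s (2 ^ i * x) - trig s (2 ^ i * y)| ^ β ≤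
      K * (((1/2:ℝ)^(i+d)) ^ α * u (i+d)) * R ^ d := by
  have hui := hpos i
  have h1 : |trig s (2 ^ i * x) - trig s (2 ^ i * y)| ≤ (1/2:ℝ)^d := by
    refine (trig_lip _ _ _).trans ?_
    rw [← mul_sub, abs_mul, abs_of_pos (by positivity)]
    calc (2:ℝ)^i * |x - y| ≤ 2^i * (1/2:ℝ)^(i+d) := by gcongr
      _ = (1/2:ℝ)^d := by
        rw [pow_add, ← mul_assoc, ← mul_pow, mul_one_div_cancel (by norm_num), one_pow, one_mul]
  have e3 : (((1/2:ℝ)^d))^β = ((1/2:ℝ)^d)^α * (Q^d * Q^d) := by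
    have h2 : Q ^ d * Q ^ d = ((1/2:ℝ)^d)^(β - α) := by
      have : Q * Q = (1/2:ℝ)^(β - α) := by rw [← hQ, Real.rpow_two, sq]
      rw [← mul_pow, this, ← Real.rpow_natCast, ← Real.rpow_mul (by norm_num), mul_comm,
        Real.rpow_mul (by norm_num), Real.rpow_natCast]
    rw [h2, ← Real.rpow_add (by positivity), add_sub_cancel]
  have e4 : ((1/2:ℝ)^(i+d))^α = ((1/2:ℝ)^i)^α * ((1/2:ℝ)^d)^α := by
    rw [pow_add, Real.mul_rpow (by positivity) (by positivity)]
  have hQR : Q ^ d ≤ R ^ d := by gcongr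
  have hud := hpos (i + d)
  calc ((1/2:ℝ)^i) ^ α * u i * |trig s (2 ^ i * x) - trig s (2 ^ i * y)| ^ β
      ≤ ((1/2:ℝ)^i) ^ α * u i * ((1/2:ℝ)^d) ^ β := by gcongr
    _ = ((1/2:ℝ)^i) ^ α * ((1/2:ℝ)^d)^α * (u i * Q^d) * Q^d := by rw [e3]; ring
    _ ≤ ((1/2:ℝ)^i) ^ α * ((1/2:ℝ)^d)^α * (K * u (i+d)) * R^d := by gcongr
    _ = _ := by rw [e4]; ring

theorem bound_high (α β : ℝ) (u : ℕ → ℝ) (R : ℝ) (hα : 1 ≤ α) (hβ : 0 < β) (hR : 1/2 ≤ R)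
    (n d : ℕ) (hpos : ∀ n, 0 < u n)
    (hu : u (n + d) ≤ u n) (s : Bool) (x y : ℝ) :
    ((1/2:ℝ)^(n+d)) ^ α * u (n+d) * |trig s (2 ^ (n+d) * x) - trig s (2 ^ (n+d) * y)| ^ β ≤
      2 ^ β * (((1/2:ℝ)^n) ^ α * u n) * R ^ d := by
  have hun := hpos n
  have hud := hpos (n + d)
  have e4 : ((1/2:ℝ)^(n+d))^α = ((1/2:ℝ)^n)^α * ((1/2:ℝ)^d)^α := by
    rw [pow_add, Real.mul_rpow (by positivity) (by positivity)]
  have e5 : ((1/2:ℝ)^d)^α ≤ R^d := by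
    calc ((1/2:ℝ)^d)^α ≤ ((1/2:ℝ)^d)^(1:ℝ) :=
          Real.rpow_le_rpow_of_exponent_ge (by positivity)
            (pow_le_one₀ (by norm_num) (by norm_num)) hα
      _ = (1/2:ℝ)^d := Real.rpow_one _
      _ ≤ R^d := by gcongr
  have h1 := trig_le_two s (2 ^ (n+d) * x) (2 ^ (n+d) * y)
  rw [e4]
  have hR0 : 0 ≤ R := by linarith
  calc ((1/2:ℝ)^n)^α * ((1/2:ℝ)^d)^α * u (n+d) *
        |trig s (2 ^ (n+d) * x) - trig s (2 ^ (n+d) * y)| ^ β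
      ≤ ((1/2:ℝ)^n)^α * R^d * u n * 2 ^ β := by gcongr
    _ = _ := by ring

theorem sumR_aux1 (R : ℝ) (h : Summable (fun p : ℤ × Bool => R ^ p.1.natAbs * 1)) (n : ℕ) :
    Summable (fun p : ℕ × Bool => R ^ ((p.1 : ℤ) - n).natAbs * 1) := by
  have := h.comp_injective (inj_aux n)
  simp only [Function.comp_def] at this
  exact this

theorem sumR_aux2 (R : ℝ) (hR : 0 < R) (h : Summable (fun p : ℤ × Bool => R ^ p.1.natAbs * 1))
    (n : ℕ) : (∑' p : ℕ × Bool, R ^ ((p.1 : ℤ) - n).natAbs * 1) ≤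
      ∑' p : ℤ × Bool, R ^ p.1.natAbs * 1 :=
  tsum_comp_le_tsum_of_inj h (fun p => by positivity) (inj_aux n)

set_option maxHeartbeats 400000 in
theorem trig_inner_sum (α β : ℝ) (hα : 1 ≤ α) (hβ : α < β) (u : ℕ → ℝ) (D : ℝ) (hD : 1 ≤ D)
    (hpos : ∀ n, 0 < u n) (hanti : Antitone u) (hstep : ∀ n, u n ≤ D * u (n+1))
    (hslow : ∀ Q : ℝ, 0 < Q → Q < 1 → ∃ K : ℝ, 1 ≤ K ∧ ∀ i d, u i * Q ^ d ≤ K * u (i + d))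
    (φ : ℝ → ℝ) (hmono : MonotoneOn φ (Icc 0 1)) (hval : ∀ n : ℕ, φ ((1/2:ℝ)^n) = u n) :
    ∃ C : ℝ, 0 < C ∧ ∀ x ∈ Icc (0:ℝ) 1, ∀ y ∈ Icc (0:ℝ) 1,
      (Summable fun p : ℕ × Bool => ((1/2:ℝ)^p.1) ^ α * u p.1 *
        |trig p.2 (2 ^ p.1 * x) - trig p.2 (2 ^ p.1 * y)| ^ β) ∧
      (∑' p : ℕ × Bool, ((1/2:ℝ)^p.1) ^ α * u p.1 *
        |trig p.2 (2 ^ p.1 * x) - trig p.2 (2 ^ p.1 * y)| ^ β) ≤ C * (|x - y| ^ α * φ |x - y|) ∧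
      |x - y| ^ α * φ |x - y| ≤ C * (∑' p : ℕ × Bool, ((1/2:ℝ)^p.1) ^ α * u p.1 *
        |trig p.2 (2 ^ p.1 * x) - trig p.2 (2 ^ p.1 * y)| ^ β) := by
  have hα0 : 0 < α := by linarith
  have hβ0 : 0 < β := by linarith
  set ε : ℝ := (β - α) / 2 with hε
  have hε0 : 0 < ε := by rw [hε]; linarith
  set Q : ℝ := (1/2:ℝ) ^ ε with hQ
  have hQ0 : 0 < Q := by positivity
  have hQ1 : Q < 1 := Real.rpow_lt_one (by norm_num) (by norm_num) hε0
  obtain ⟨K, hK1, hK⟩ := hslow Q hQ0 hQ1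
  set R : ℝ := max Q (1/2) with hR
  have hR0 : 0 < R := lt_max_of_lt_left hQ0
  have hR1 : R < 1 := max_lt hQ1 (by norm_num)
  have hsumZ : Summable (fun z : ℤ => R ^ z.natAbs) := by
    apply Summable.of_nat_of_neg
    · simpa using summable_geometric_of_lt_one hR0.le hR1
    · simpa using summable_geometric_of_lt_one hR0.le hR1
  have hsumB : Summable (fun _ : Bool => (1:ℝ)) := (hasSum_fintype _).summable
  have hsumZB : Summable (fun p : ℤ × Bool => R ^ p.1.natAbs * 1) :=
    hsumZ.mul_of_nonneg hsumB (fun z => by positivity) (fun _ => zero_le_one)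
  set M : ℝ := ∑' p : ℤ × Bool, R ^ p.1.natAbs * 1 with hM
  have hM0 : 0 ≤ M := tsum_nonneg (fun p => by positivity)
  set T : ℝ := K + 2 ^ β with hT
  have h2β : (0:ℝ) < 2 ^ β := by positivity
  have hT0 : 0 < T := by positivity
  refine ⟨max 1 (max (T * (2 ^ α * D) * M) (6 ^ β)), lt_max_of_lt_left one_pos, ?_⟩
  intro x hx y hy
  set t := |x - y| with ht
  have ht1 : t ≤ 1 := by
    rw [ht, abs_le]; constructor <;> linarith [hx.1, hx.2, hy.1, hy.2]
  have ht0 : 0 ≤ t := abs_nonneg _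
  have hterm0 : ∀ p : ℕ × Bool, 0 ≤ ((1/2:ℝ)^p.1) ^ α * u p.1 *
        |trig p.2 (2 ^ p.1 * x) - trig p.2 (2 ^ p.1 * y)| ^ β := by
    intro p; have := hpos p.1; positivity
  rcases ht0.eq_or_lt with h0 | htpos
  · have hxy : x = y := by
      rw [ht] at h0; exact sub_eq_zero.1 (abs_eq_zero.1 h0.symm)
    rw [← h0]
    subst hxy
    simp [Real.zero_rpow hα0.ne', Real.zero_rpow hβ0.ne', summable_zero]
  obtain ⟨n, hn1, hn2⟩ := exists_nat_pow_near_of_lt_one htpos ht1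
    (by norm_num : (0:ℝ) < 1/2) (by norm_num)
  have htm : t ∈ Icc (0:ℝ) 1 := ⟨ht0, ht1⟩
  have hpm : ∀ j : ℕ, (1/2:ℝ)^j ∈ Icc (0:ℝ) 1 :=
    fun j => ⟨by positivity, pow_le_one₀ (by norm_num) (by norm_num)⟩
  have hφ1 : u (n+1) ≤ φ t := by rw [← hval]; exact hmono (hpm _) htm hn1.le
  have hφ2 : φ t ≤ u n := by rw [← hval]; exact hmono htm (hpm _) hn2
  have hun := hpos n
  have hun1 := hpos (n+1)
  set B : ℝ := ((1/2:ℝ)^n)^α * u n with hB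
  have hB0 : 0 < B := by positivity
  have hBf : B ≤ 2 ^ α * D * (t ^ α * φ t) := by
    have e1 : ((1/2:ℝ)^n)^α = 2 ^ α * ((1/2:ℝ)^(n+1))^α := by
      rw [← Real.mul_rpow (by norm_num) (by positivity)]
      congr 1
      rw [pow_succ]; ring
    rw [hB, e1]
    have e2 := hstep n
    calc 2 ^ α * ((1/2:ℝ)^(n+1))^α * u n ≤ 2 ^ α * t ^ α * (D * φ t) := by
          gcongr
          exact e2.trans (by gcongr)
      _ = _ := by ring
  have hfB : t ^ α * φ t ≤ B := by
    rw [hB]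
    have : 0 ≤ φ t := hun1.le.trans hφ1
    gcongr
  have hdiff : ∀ i : ℕ, |2 ^ i * x - 2 ^ i * y| = 2 ^ i * t := by
    intro i; rw [← mul_sub, abs_mul, abs_of_pos (by positivity)]
  have hbound : ∀ p : ℕ × Bool, ((1/2:ℝ)^p.1) ^ α * u p.1 *
        |trig p.2 (2 ^ p.1 * x) - trig p.2 (2 ^ p.1 * y)| ^ β
        ≤ T * B * (R ^ ((p.1 : ℤ) - n).natAbs * 1) := by
    intro p
    rcases le_total p.1 n with hin | hin
    · obtain ⟨d, hd⟩ := Nat.exists_eq_add_of_le hin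
      have h1 := bound_low α β u Q R K hQ0 (le_max_left _ _) (by linarith)
        (by rw [hQ, ← Real.rpow_mul (by norm_num)]; congr 1; rw [hε]; ring) p.1 d hpos (hK p.1 d) p.2
        x y (by rw [← hd]; exact hn2) hβ0
      rw [← hd, ← hB] at h1
      have hnat : ((p.1 : ℤ) - n).natAbs = d := by rw [hd]; exact natAbs_aux1 _ d
      rw [hnat, mul_one]
      refine h1.trans ?_
      have : K ≤ T := by rw [hT]; linarith
      gcongr
    · obtain ⟨d, hd⟩ := Nat.exists_eq_add_of_le hin
      have h1 := bound_high α β u R hα hβ0 (le_max_right _ _) n d hpos (hanti (Nat.le_add_right n d)) p.2 x y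
      rw [← hd, ← hB] at h1
      have hnat : ((p.1 : ℤ) - n).natAbs = d := by rw [hd]; exact natAbs_aux2 _ d
      rw [hnat, mul_one]
      refine h1.trans ?_
      have : 2 ^ β ≤ T := by rw [hT]; linarith
      gcongr
  have hsR := sumR_aux1 R hsumZB n
  have hsR' := sumR_aux2 R hR0 hsumZB n
  rw [← hM] at hsR'
  have hS := Summable.of_nonneg_of_le hterm0 hbound (hsR.mul_left _)
  have hf0 : 0 ≤ t ^ α * φ t := by
    have : 0 ≤ φ t := hun1.le.trans hφ1
    positivity
  refine ⟨hS, ?_, ?_⟩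
  · calc _ ≤ ∑' p : ℕ × Bool, T * B * (R ^ ((p.1 : ℤ) - n).natAbs * 1) :=
          hS.tsum_le_tsum hbound (hsR.mul_left _)
      _ = T * B * ∑' p : ℕ × Bool, (R ^ ((p.1 : ℤ) - n).natAbs * 1) := tsum_mul_left
      _ ≤ T * (2 ^ α * D * (t ^ α * φ t)) * M := by gcongr
      _ = (T * (2 ^ α * D) * M) * (t ^ α * φ t) := by ring
      _ ≤ _ := by
        gcongr
        exact (le_max_left _ _).trans (le_max_right _ _)
  · obtain ⟨s, hs⟩ := trig_low (2^n * x) (2^n * y)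
      (by
        rw [hdiff]
        calc (1/2:ℝ) = 2^n * (1/2)^(n+1) := by
              rw [pow_succ, ← mul_assoc, ← mul_pow]; norm_num
          _ ≤ _ := by gcongr)
      (by
        rw [hdiff]
        calc (2:ℝ)^n * t ≤ 2^n * (1/2)^n := by gcongr
          _ = 1 := by rw [← mul_pow]; norm_num)
    have h1 := hS.le_tsum (n, s) (fun p _ => hterm0 p)
    simp only at h1
    have h2 : B * (1/6)^β ≤ ((1/2:ℝ)^n)^α * u n *
        |trig s (2 ^ n * x) - trig s (2 ^ n * y)| ^ β := by
      rw [hB]; gcongr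
    have h3 := h2.trans h1
    have h66 : (6:ℝ)^β * (1/6)^β = 1 := by
      rw [← Real.mul_rpow (by norm_num) (by norm_num)]; norm_num
    calc t ^ α * φ t ≤ B := hfB
      _ = 6 ^ β * (B * (1/6)^β) := by rw [mul_left_comm, h66, mul_one]
      _ ≤ 6 ^ β * _ := by gcongr
      _ ≤ _ := by
        have := tsum_nonneg (L := SummationFilter.unconditional _) hterm0
        gcongr
        exact (le_max_right _ _).trans (le_max_right _ _)

theorem part2 (α β : ℝ) (hα : 1 ≤ α) (hβ : α < β) (u : ℕ → ℝ) (D : ℝ) (hD : 1 ≤ D)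
    (hpos : ∀ n, 0 < u n) (hanti : Antitone u) (hstep : ∀ n, u n ≤ D * u (n+1))
    (hslow : ∀ Q : ℝ, 0 < Q → Q < 1 → ∃ K : ℝ, 1 ≤ K ∧ ∀ i d, u i * Q ^ d ≤ K * u (i + d))
    (φ : ℝ → ℝ) (hmono : MonotoneOn φ (Icc 0 1)) (hval : ∀ n : ℕ, φ ((1/2:ℝ)^n) = u n)
    (hnn : ∀ t ∈ Icc (0:ℝ) 1, 0 ≤ φ t) :
    BorelReducible (EF (fun t => t ^ α * φ t)) (lpRel β) := by
  obtain ⟨C, hC, h⟩ := trig_inner_sum α β hα hβ u D hD hpos hanti hstep hslow φ hmono hval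
  have hβ0 : 0 < β := by linarith
  obtain ⟨e⟩ : Nonempty (ℕ ≃ ℕ × (ℕ × Bool)) := by
    obtain ⟨i⟩ := nonempty_denumerable (ℕ × (ℕ × Bool))
    exact ⟨(Denumerable.eqv _).symm⟩
  refine ⟨fun x j => (((1/2:ℝ)^(e j).2.1) ^ α * u (e j).2.1) ^ (1/β) *
    trig (e j).2.2 (2 ^ (e j).2.1 * (x (e j).1 : ℝ)), ?_, ?_⟩
  · refine measurable_pi_lambda _ fun j => ?_
    have := trig_meas (e j).2.2
    refine Measurable.const_mul (this.comp ?_) _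
    fun_prop
  intro x y
  unfold EF lpRel
  set F : ℕ × (ℕ × Bool) → ℝ := fun p => ((1/2:ℝ)^p.2.1) ^ α * u p.2.1 *
        |trig p.2.2 (2 ^ p.2.1 * (x p.1 : ℝ)) - trig p.2.2 (2 ^ p.2.1 * (y p.1 : ℝ))| ^ β with hF
  have hF0 : 0 ≤ F := by
    intro p; have := hpos p.2.1; simp only [hF, Pi.zero_apply]; positivity
  have e1 : (fun j => |(((1/2:ℝ)^(e j).2.1) ^ α * u (e j).2.1) ^ (1/β) *
    trig (e j).2.2 (2 ^ (e j).2.1 * (x (e j).1 : ℝ)) -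
    (((1/2:ℝ)^(e j).2.1) ^ α * u (e j).2.1) ^ (1/β) *
    trig (e j).2.2 (2 ^ (e j).2.1 * (y (e j).1 : ℝ))| ^ β) = F ∘ e := by
    funext j
    simp only [hF, Function.comp]
    have := hpos (e j).2.1
    rw [← mul_sub, abs_mul, Real.mul_rpow (abs_nonneg _) (abs_nonneg _),
      abs_of_pos (by positivity), ← Real.rpow_mul (by positivity), one_div_mul_cancel hβ0.ne',
      Real.rpow_one]
  rw [e1, e.summable_iff, summable_prod_of_nonneg hF0]
  have h' := fun n => h (x n) (x n).2 (y n) (y n).2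
  have hf0 : ∀ n, 0 ≤ |(x n : ℝ) - y n| ^ α * φ |(x n : ℝ) - y n| := by
    intro n
    have : 0 ≤ φ |(x n : ℝ) - y n| := hnn _ ⟨abs_nonneg _, by
      rw [abs_le]; constructor <;> linarith [(x n).2.1, (x n).2.2, (y n).2.1, (y n).2.2]⟩
    positivity
  constructor
  · intro hs
    refine ⟨fun n => (h' n).1, Summable.of_nonneg_of_le (fun n => tsum_nonneg fun p => hF0 _)
      (fun n => (h' n).2.1) (hs.mul_left C)⟩
  · rintro ⟨-, hs⟩
    exact Summable.of_nonneg_of_le hf0 (fun n => (h' n).2.2) (hs.mul_left C)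

theorem part1b (α : ℝ) (hα : 1 ≤ α) (u : ℕ → ℝ) (D : ℝ) (hD : 1 ≤ D)
    (hpos : ∀ n, 0 < u n) (hle : ∀ n, u n ≤ 1)
    (k : ℕ → ℕ) (hkn : ∀ n, n ≤ k n) (hjump : ∀ n, u (k n) ≤ D * u (2 * k n))
    (φ : ℝ → ℝ) (hmono : MonotoneOn φ (Icc 0 1)) (hval : ∀ n : ℕ, φ ((1/2:ℝ)^n) = u n)
    (hnn : ∀ t ∈ Icc (0:ℝ) 1, 0 ≤ φ t) :
    BorelReducible (EF (fun t => t ^ α)) (EF (fun t => t ^ α * φ t)) := by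
  have hα0 : 0 < α := by linarith
  set c : ℕ → ℝ := fun n => (1/2:ℝ)^(k n) with hc
  have hc0 : ∀ n, 0 < c n := fun n => by simp only [hc]; positivity
  have hc1 : ∀ n, c n ≤ 1 := fun n => pow_le_one₀ (by norm_num) (by norm_num)
  set w : ℕ → ℝ := fun n => c n ^ α * u (k n) with hw
  have hw0 : ∀ n, 0 < w n := fun n => mul_pos (Real.rpow_pos_of_pos (hc0 n) _) (hpos _)
  have hw1 : ∀ n, w n ≤ 1 := fun n =>
    mul_le_one₀ (Real.rpow_le_one (hc0 n).le (hc1 n) hα0.le) (hpos _).le (hle _)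
  set N : ℕ → ℕ := fun n => ⌈1 / w n⌉₊ with hN
  have hN1 : ∀ n, 1 ≤ N n * w n := by
    intro n
    have := Nat.le_ceil (1 / w n)
    rwa [div_le_iff₀ (hw0 n)] at this
  have hN2 : ∀ n, N n * w n ≤ 2 := by
    intro n
    have h1 := (Nat.ceil_lt_add_one (one_div_pos.2 (hw0 n)).le).le
    calc N n * w n ≤ (1 / w n + 1) * w n := by
          have := (hw0 n).le
          gcongr
      _ = 1 + w n := by have := (hw0 n).ne'; field_simp
      _ ≤ 2 := by linarith [hw1 n]
  have hmem : ∀ n (z : Icc (0:ℝ) 1), c n * (z:ℝ) ∈ Icc (0:ℝ) 1 := fun n z =>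
    ⟨mul_nonneg (hc0 n).le z.2.1, mul_le_one₀ (hc1 n) z.2.1 z.2.2⟩
  refine ⟨fun x j => if (Nat.unpair j).2 < N (Nat.unpair j).1 then
      ⟨c (Nat.unpair j).1 * (x (Nat.unpair j).1 : ℝ), hmem _ _⟩ else ⟨0, by simp⟩, ?_, ?_⟩
  · refine measurable_pi_lambda _ fun j => ?_
    split_ifs
    · refine Measurable.subtype_mk ?_
      fun_prop
    · exact measurable_const
  intro x y
  unfold EF
  set t : ℕ → ℝ := fun n => |(x n : ℝ) - y n| with ht
  have ht0 : ∀ n, 0 ≤ t n := fun n => abs_nonneg _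
  have ht1 : ∀ n, t n ≤ 1 := by
    intro n
    simp only [ht]
    rw [abs_le]; constructor <;> linarith [(x n).2.1, (x n).2.2, (y n).2.1, (y n).2.2]
  have hctm : ∀ n, c n * t n ∈ Icc (0:ℝ) 1 := fun n => hmem n ⟨t n, ht0 n, ht1 n⟩
  have hcm : ∀ n, c n ∈ Icc (0:ℝ) 1 := fun n => ⟨(hc0 n).le, hc1 n⟩
  set v : ℕ → ℝ := fun n => (c n * t n) ^ α * φ (c n * t n) with hv
  have hv0 : ∀ n, 0 ≤ v n := fun n =>
    mul_nonneg (Real.rpow_nonneg (hctm n).1 _) (hnn _ (hctm n))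
  set F : ℕ × ℕ → ℝ := fun p => if p.2 < N p.1 then v p.1 else 0 with hF
  have hF0 : 0 ≤ F := by
    intro p
    simp only [hF, Pi.zero_apply]
    split_ifs
    · exact hv0 _
    · exact le_rfl
  have hFs : ∀ n, HasSum (fun j => F (n, j)) (N n * v n) := by
    intro n
    have := hasSum_sum_of_ne_finset_zero (L := SummationFilter.unconditional ℕ) (f := fun j => F (n, j)) (s := Finset.range (N n))
      (by intro j hj; simp only [Finset.mem_range] at hj; simp [hF, hj])
    convert this using 1
    rw [Finset.sum_congr rfl (g := fun _ => v n)
      (by intro j hj; simp only [Finset.mem_range] at hj; simp [hF, hj])]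
    simp
  have e1 : ∀ G : ℕ → ℝ, G = F ∘ Nat.pairEquiv.symm → (Summable G ↔ Summable fun n => N n * v n) := by
    intro G hG
    rw [hG, Nat.pairEquiv.symm.summable_iff, summable_prod_of_nonneg hF0]
    have : (fun n => ∑' j, F (n, j)) = fun n => N n * v n := funext fun n => (hFs n).tsum_eq
    rw [this]
    exact ⟨fun h => h.2, fun h => ⟨fun n => (hFs n).summable, h⟩⟩
  refine Iff.trans ?_ (e1 _ ?_).symm
  · change Summable (fun n => t n ^ α) ↔ _
    have hφle : ∀ n, φ (c n * t n) ≤ u (k n) := by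
      intro n
      rw [← hval]
      exact hmono (hctm n) (hcm n) (mul_le_of_le_one_right (hc0 n).le (ht1 n))
    have hta : ∀ n, 0 ≤ t n ^ α := fun n => Real.rpow_nonneg (ht0 n) _
    have hca : ∀ n, 0 ≤ c n ^ α := fun n => Real.rpow_nonneg (hc0 n).le _
    constructor
    · intro hs
      refine Summable.of_nonneg_of_le (fun n => mul_nonneg (Nat.cast_nonneg _) (hv0 n)) (fun n => ?_)
        (hs.mul_left 2)
      calc N n * v n = N n * (c n ^ α * φ (c n * t n)) * t n ^ α := by
            simp only [hv]; rw [Real.mul_rpow (hc0 n).le (ht0 n)]; ring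
        _ ≤ N n * (c n ^ α * u (k n)) * t n ^ α := by
            have h1 := hφle n
            have h2 := hta n
            have h3 := hca n
            gcongr
        _ ≤ 2 * t n ^ α := by
            have h2 := hta n
            have := hN2 n
            gcongr
    · intro hs
      refine Summable.of_nonneg_of_le hta (fun n => ?_)
        ((hs.mul_left D).add (summable_geometric_of_lt_one (by norm_num : (0:ℝ) ≤ 1/2) (by norm_num)))
      have hNv : 0 ≤ D * (N n * v n) :=
        mul_nonneg (by linarith) (mul_nonneg (Nat.cast_nonneg _) (hv0 n))
      rcases le_total (t n) (c n) with htc | htc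
      · have : t n ^ α ≤ (1/2)^n := by
          calc t n ^ α ≤ t n ^ (1:ℝ) := Real.rpow_le_rpow_of_exponent_ge' (ht0 n) (ht1 n) (by norm_num) hα
            _ = t n := Real.rpow_one _
            _ ≤ c n := htc
            _ ≤ (1/2)^n := pow_le_pow_of_le_one (by norm_num) (by norm_num) (hkn n)
        linarith
      · have h1 : u (2 * k n) ≤ φ (c n * t n) := by
          rw [← hval]
          refine hmono ⟨by positivity, pow_le_one₀ (by norm_num) (by norm_num)⟩ (hctm n) ?_
          have : (1/2:ℝ)^(2 * k n) = c n * c n := by simp only [hc]; rw [two_mul, pow_add]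
          rw [this]
          have := (hc0 n).le
          gcongr
        have h2 : u (k n) ≤ D * φ (c n * t n) := (hjump n).trans (by gcongr)
        have h3 := hta n
        have h4 := hca n
        have h5 : t n ^ α ≤ D * (N n * v n) := by
          calc t n ^ α = 1 * t n ^ α := (one_mul _).symm
            _ ≤ (N n * w n) * t n ^ α := by
              have := hN1 n
              gcongr
            _ = N n * (c n ^ α * u (k n)) * t n ^ α := rfl
            _ ≤ N n * (c n ^ α * (D * φ (c n * t n))) * t n ^ α := by gcongr
            _ = D * (N n * v n) := by
              simp only [hv]; rw [Real.mul_rpow (hc0 n).le (ht0 n)]; ring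
        have : (0:ℝ) ≤ (1/2)^n := by positivity
        linarith
  · funext j
    simp only [hF, hv, ht, Function.comp, Nat.pairEquiv_symm_apply]
    split_ifs
    · simp only
      rw [← mul_sub, abs_mul, abs_of_pos (hc0 _)]
    · simp [Real.zero_rpow hα0.ne']

noncomputable def clampZ (j : ℤ) (x : ℝ) : ℝ := max 0 (min 1 (x - j))

theorem clampZ_mem (j : ℤ) (x : ℝ) : clampZ j x ∈ Icc (0:ℝ) 1 :=
  ⟨le_max_left _ _, max_le zero_le_one (min_le_left _ _)⟩

theorem clamp_sum (α : ℝ) (hα : 1 ≤ α) (x y : ℝ) :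
    (Summable fun j : ℤ => |clampZ j x - clampZ j y| ^ α) ∧
    (∑' j : ℤ, |clampZ j x - clampZ j y| ^ α) ≤ 3 * |x - y| ^ α ∧
    (min 1 |x - y|) ^ α ≤ 2 ^ α * ∑' j : ℤ, |clampZ j x - clampZ j y| ^ α := by
  have hα0 : 0 < α := by linarith
  wlog hxy : x ≤ y generalizing x y
  · have := this y x (le_of_not_ge hxy)
    simpa only [abs_sub_comm y x, abs_sub_comm (clampZ _ y)] using this
  have hD : |x - y| = y - x := by rw [abs_sub_comm, abs_of_nonneg (by linarith)]
  rw [hD]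
  have hD0 : 0 ≤ y - x := by linarith
  set s : Finset ℤ := Finset.Icc ⌊x⌋ ⌊y⌋ with hs
  have hz : ∀ j ∉ s, |clampZ j x - clampZ j y| ^ α = 0 := by
    intro j hj
    have : clampZ j x = clampZ j y := by
      simp only [hs, Finset.mem_Icc, not_and_or, not_le] at hj
      unfold clampZ
      rcases hj with hj | hj
      · have h1 : (j:ℝ) + 1 ≤ x := by
          have : j + 1 ≤ ⌊x⌋ := hj
          have := Int.le_floor.1 this
          push_cast at this; exact this
        rw [min_eq_left (by linarith), min_eq_left (by linarith)]
      · have h1 : y < j := Int.floor_lt.1 hj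
        rw [max_eq_left ((min_le_right _ _).trans (by linarith)),
          max_eq_left ((min_le_right _ _).trans (by linarith))]
    rw [this, sub_self, abs_zero, Real.zero_rpow hα0.ne']
  have hsum := hasSum_sum_of_ne_finset_zero (L := SummationFilter.unconditional ℤ) hz
  have hnn : ∀ j : ℤ, 0 ≤ |clampZ j x - clampZ j y| ^ α := fun j => by positivity
  have hle1 : ∀ j : ℤ, |clampZ j x - clampZ j y| ≤ 1 := by
    intro j
    have h1 := clampZ_mem j x
    have h2 := clampZ_mem j y
    rw [abs_le]; constructor <;> linarith [h1.1, h1.2, h2.1, h2.2]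
  have hleD : ∀ j : ℤ, |clampZ j x - clampZ j y| ≤ y - x := by
    intro j
    unfold clampZ
    rw [abs_le]
    constructor <;>
    rcases max_cases 0 (min 1 (x - j)) with ⟨h1, _⟩ | ⟨h1, _⟩ <;>
    rcases max_cases 0 (min 1 (y - j)) with ⟨h2, _⟩ | ⟨h2, _⟩ <;>
    rcases min_cases 1 (x - j) with ⟨h3, _⟩ | ⟨h3, _⟩ <;>
    rcases min_cases 1 (y - j) with ⟨h4, _⟩ | ⟨h4, _⟩ <;> linarith
  refine ⟨hsum.summable, ?_, ?_⟩
  · rw [hsum.tsum_eq]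
    have hcard : (s.card : ℝ) ≤ (y - x) + 2 := by
      have h1 : ⌊x⌋ ≤ ⌊y⌋ := Int.floor_mono hxy
      have h2 : ((s.card : ℤ) : ℝ) = ((⌊y⌋ + 1 - ⌊x⌋ : ℤ) : ℝ) := by
        rw [hs, Int.card_Icc_of_le _ _ (by omega)]
      push_cast at h2
      rw [h2]
      linarith [Int.floor_le y, Int.lt_floor_add_one x]
    rcases le_total (y - x) 1 with h | h
    · calc _ ≤ s.card • (y - x) ^ α :=
            Finset.sum_le_card_nsmul _ _ _ fun j _ => by
              have := hleD j
              gcongr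
        _ = s.card * (y - x) ^ α := nsmul_eq_mul _ _
        _ ≤ 3 * (y - x) ^ α := by
          have := Real.rpow_nonneg hD0 α
          gcongr; linarith
    · calc _ ≤ s.card • (1:ℝ) :=
            Finset.sum_le_card_nsmul _ _ _ fun j _ =>
              Real.rpow_le_one (abs_nonneg _) (hle1 j) hα0.le
        _ = s.card := by simp
        _ ≤ 3 * (y - x) := by linarith
        _ ≤ 3 * (y - x) ^ α := by
          have := Real.self_le_rpow_of_one_le h hα
          gcongr
  · have hex : ∃ j : ℤ, min 1 (y - x) ≤ 2 * |clampZ j x - clampZ j y| := by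
      by_contra hcon
      push Not at hcon
      have h1 := hcon ⌊x⌋
      have h2 := hcon (⌊x⌋ + 1)
      have g1 := Int.floor_le x
      have g2 := Int.lt_floor_add_one x
      rw [abs_sub_comm] at h1 h2
      have h1' := (mul_le_mul_of_nonneg_left (le_abs_self (clampZ ⌊x⌋ y - clampZ ⌊x⌋ x)) (by norm_num : (0:ℝ) ≤ 2)).trans_lt h1
      have h2' := (mul_le_mul_of_nonneg_left (le_abs_self (clampZ (⌊x⌋+1) y - clampZ (⌊x⌋+1) x)) (by norm_num : (0:ℝ) ≤ 2)).trans_lt h2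
      unfold clampZ at h1' h2'
      push_cast at h1' h2'
      rw [min_eq_right (by linarith : x - ⌊x⌋ ≤ 1), max_eq_right (by linarith : 0 ≤ x - ⌊x⌋),
        max_eq_right (le_min zero_le_one (by linarith) : 0 ≤ min 1 (y - ⌊x⌋))] at h1'
      rw [max_eq_left ((min_le_right _ _).trans (by linarith) : min 1 (x - (⌊x⌋ + 1)) ≤ 0)] at h2'
      rcases max_cases 0 (min 1 (y - (⌊x⌋+1))) with ⟨k1, _⟩ | ⟨k1, _⟩ <;>
      rcases min_cases 1 (y - (⌊x⌋+1)) with ⟨k2, _⟩ | ⟨k2, _⟩ <;>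
      rcases min_cases 1 (y - ⌊x⌋) with ⟨k3, _⟩ | ⟨k3, _⟩ <;>
      rcases min_cases 1 (y - x) with ⟨k4, _⟩ | ⟨k4, _⟩ <;> linarith
    obtain ⟨j, hj⟩ := hex
    have h1 := hsum.summable.le_tsum j (fun i _ => hnn i)
    calc (min 1 (y - x)) ^ α ≤ (2 * |clampZ j x - clampZ j y|) ^ α := by
          have : 0 ≤ min 1 (y - x) := le_min zero_le_one hD0
          gcongr
      _ = 2 ^ α * |clampZ j x - clampZ j y| ^ α := Real.mul_rpow (by norm_num) (abs_nonneg _)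
      _ ≤ _ := by gcongr

theorem part1a (α : ℝ) (hα : 1 ≤ α) : BorelReducible (lpRel α) (EF (fun t => t ^ α)) := by
  have hα0 : 0 < α := by linarith
  obtain ⟨e⟩ : Nonempty (ℕ ≃ ℕ × ℤ) := ⟨(Denumerable.eqv _).symm⟩
  refine ⟨fun x j => ⟨clampZ (e j).2 (x (e j).1), clampZ_mem _ _⟩, ?_, ?_⟩
  · refine measurable_pi_lambda _ fun j => Measurable.subtype_mk ?_
    unfold clampZ
    fun_prop
  intro x y
  unfold EF lpRel
  set F : ℕ × ℤ → ℝ := fun p => |clampZ p.2 (x p.1) - clampZ p.2 (y p.1)| ^ α with hF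
  have hF0 : 0 ≤ F := fun p => by simp only [hF, Pi.zero_apply]; positivity
  change _ ↔ Summable (F ∘ e)
  rw [e.summable_iff, summable_prod_of_nonneg hF0]
  have h := fun n => clamp_sum α hα (x n) (y n)
  constructor
  · intro hs
    exact ⟨fun n => (h n).1, Summable.of_nonneg_of_le (fun n => tsum_nonneg fun j => hF0 _)
      (fun n => (h n).2.1) (hs.mul_left 3)⟩
  · rintro ⟨-, hs⟩
    have hm : Summable fun n => (min 1 |x n - y n|) ^ α :=
      Summable.of_nonneg_of_le (fun n => by positivity) (fun n => (h n).2.2) (hs.mul_left _)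
    refine hm.of_norm_bounded_eventually_nat ?_
    have hev := hm.tendsto_atTop_zero.eventually (gt_mem_nhds (zero_lt_one))
    filter_upwards [hev] with n hn
    rw [Real.norm_of_nonneg (by positivity)]
    rcases le_total 1 |x n - y n| with h1 | h1
    · rw [min_eq_left h1, Real.one_rpow] at hn
      exact absurd hn (lt_irrefl _)
    · rw [min_eq_right h1]

theorem stmt15 (α : ℝ) (hα : 1 ≤ α)
    (a : ℕ → ℕ) (ha0 : a 0 = 0) (haS : ∀ l, a (l+1) = a l + 1 + l * a l)
    (δs : ℕ → ℝ) (hδmem : ∀ m, δs m ∈ Ioo (0:ℝ) 1)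
    (hinf : 0 < ⨅ m, δs m) (hsup : (⨆ m, δs m) < 1)
    (k : ℕ → ℕ) (hkmono : StrictMono k) (hk0 : 2 ≤ k 0)
    (hk2 : ∀ m, 2 * k m ≤ k (m+1))
    (U : Set ℕ) (u : ℕ → ℝ) (hu0 : u 0 = 1)
    (huk : ∀ (n m l : ℕ), n + 1 = k m → a l ≤ m → m < a (l+1) → l ∈ U →
      u (n+1) = δs m * u n)
    (hunk : ∀ n : ℕ,
      (¬ ∃ m l, n + 1 = k m ∧ a l ≤ m ∧ m < a (l+1) ∧ l ∈ U) → u (n+1) = u n)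
    (φU : ℝ → ℝ)
    (hφUc : ContinuousOn φU (Icc 0 1)) (hφUm : MonotoneOn φU (Icc 0 1))
    (hφUnn : ∀ t ∈ Icc (0:ℝ) 1, 0 ≤ φU t)
    (hφUval : ∀ n : ℕ, φU ((1/2:ℝ)^n) = u n) :
    ∀ β : ℝ, α < β →
      BorelReducible (lpRel α) (EF (fun t => t ^ α * φU t)) ∧
      BorelReducible (EF (fun t => t ^ α * φU t)) (lpRel β) := by
  intro β hβ
  have hbdd : BddBelow (range δs) := ⟨0, by rintro _ ⟨m, rfl⟩; exact (hδmem m).1.le⟩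
  set δ := ⨅ m, δs m with hδ
  have hδle : ∀ m, δ ≤ δs m := fun m => ciInf_le hbdd m
  have hδ1 : δ ≤ 1 := (hδle 0).trans (hδmem 0).2.le
  have hD : 1 ≤ δ⁻¹ := (one_le_inv₀ hinf).2 hδ1
  have hcase : ∀ n, u (n+1) = u n ∨ ∃ m, n + 1 = k m ∧ u (n+1) = δs m * u n := by
    intro n
    by_cases h : ∃ m l, n + 1 = k m ∧ a l ≤ m ∧ m < a (l+1) ∧ l ∈ U
    · obtain ⟨m, l, h1, h2, h3, h4⟩ := h
      exact Or.inr ⟨m, h1, huk n m l h1 h2 h3 h4⟩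
    · exact Or.inl (hunk n h)
  have hpos : ∀ n, 0 < u n := by
    intro n
    induction n with
    | zero => rw [hu0]; exact one_pos
    | succ n ih =>
      rcases hcase n with h | ⟨m, -, h⟩
      · rw [h]; exact ih
      · rw [h]; exact mul_pos (hδmem m).1 ih
  have hanti : Antitone u := by
    refine antitone_nat_of_succ_le fun n => ?_
    rcases hcase n with h | ⟨m, -, h⟩
    · rw [h]
    · rw [h]; exact mul_le_of_le_one_left (hpos n).le (hδmem m).2.le
  have hstep : ∀ n, u n ≤ δ⁻¹ * u (n+1) := by
    intro n
    rw [le_inv_mul_iff₀ hinf]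
    have := hpos n
    rcases hcase n with h | ⟨m, -, h⟩
    · rw [h]; exact mul_le_of_le_one_left this.le hδ1
    · rw [h]; have := hδle m; gcongr
  have hconst : ∀ n, (¬ ∃ m, n + 1 = k m) → u (n+1) = u n := by
    intro n hn
    rcases hcase n with h | ⟨m, hm, h⟩
    · exact h
    · exact absurd ⟨m, hm⟩ hn
  have hle : ∀ n, u n ≤ 1 := fun n => by rw [← hu0]; exact hanti (Nat.zero_le n)
  have hjump : ∀ m, u (k m) ≤ δ⁻¹ * u (2 * k m) := by
    intro m
    have hflat : ∀ j, k m + j < k (m+1) → u (k m + j) = u (k m) := by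
      intro j
      induction j with
      | zero => intro _; rfl
      | succ j ih =>
        intro hj
        rw [← ih (by omega), ← add_assoc]
        apply hconst
        rintro ⟨m', hm'⟩
        have h1 : m < m' := hkmono.lt_iff_lt.1 (by omega)
        have h2 : m' < m + 1 := hkmono.lt_iff_lt.1 (by omega)
        omega
    have h2 := hk2 m
    have hk1 : 2 ≤ k m := hk0.trans (hkmono.monotone (Nat.zero_le m))
    have h3 := hflat (k m - 1) (by omega)
    have h4 := hstep (k m + (k m - 1))
    rw [h3] at h4
    have h5 : k m + (k m - 1) + 1 = 2 * k m := by omega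
    rwa [h5] at h4
  refine ⟨red_trans (part1a α hα) (part1b α hα u δ⁻¹ hD hpos hle k (fun n => hkmono.le_apply) hjump φU hφUm
    hφUval hφUnn), part2 α β hα hβ u δ⁻¹ hD hpos hanti hstep
    (fun Q h0 h1 => slow u δ⁻¹ hD k hkmono hk2 hpos hstep hconst Q h0 h1) φU hφUm hφUval hφUnn⟩
end
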